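/- arXiv:1508.06766 — 2 statements merged into one kernel-verified Lean document; each statement's English description precedes it below -/
import Mathlib

section
/- Let p>2, let u be a nonnegative classical solution of u_t−Δu=|∇u|^p in Q_T with u=0 on Γ_T, having an isolated gradient blowup point at (0,0,T) and satisfying the monotonicity condition x·u_x≤0 in Q_T, and let v:=u(·,·,T). Then for each ε∈(0,1) there exist C>0 and ρ∈(0,L/2) such that, with β=1/(p−1), v_y(x,y) ≥ [(v_y((1+ε)x,0))^{1−p}+(p−1)y]^{−β} − C for all (x,y)∈ω̄_ρ∖{(0,0)} with x≥0, where ω_ρ=(−ρ,ρ)×(0,ρ). -/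
open Real Set Filter MeasureTheory

noncomputable section

/-- Partial derivative of `u(x,y,t)` with respect to `x`. -/
def pdx (u : ℝ → ℝ → ℝ → ℝ) (x y t : ℝ) : ℝ := deriv (fun s => u s y t) x

/-- Partial derivative with respect to `y`. -/
def pdy (u : ℝ → ℝ → ℝ → ℝ) (x y t : ℝ) : ℝ := deriv (fun s => u x s t) y

/-- Partial derivative with respect to `t`. -/
def pdt (u : ℝ → ℝ → ℝ → ℝ) (x y t : ℝ) : ℝ := deriv (fun s => u x y s) t

/-- Second partial derivative with respect to `x`. -/
def pdxx (u : ℝ → ℝ → ℝ → ℝ) (x y t : ℝ) : ℝ := deriv (fun s => pdx u s y t) x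

/-- Second partial derivative with respect to `y`. -/
def pdyy (u : ℝ → ℝ → ℝ → ℝ) (x y t : ℝ) : ℝ := deriv (fun s => pdy u x s t) y

/-- Mixed second partial derivative `u_{xy}` (first `x`, then `y`). -/
def pdxy (u : ℝ → ℝ → ℝ → ℝ) (x y t : ℝ) : ℝ := deriv (fun s => pdx u x s t) y

/-- The norm of the spatial gradient, `|∇u| = (u_x² + u_y²)^{1/2}`. -/
def gradNorm (u : ℝ → ℝ → ℝ → ℝ) (x y t : ℝ) : ℝ :=
  Real.sqrt ((pdx u x y t) ^ 2 + (pdy u x y t) ^ 2)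

/-- `C^{2,1}`-type regularity of `u` at the point `(x,y,t)`: twice (continuously)
differentiable in the space variables and once in time. -/
def C21At (u : ℝ → ℝ → ℝ → ℝ) (x y t : ℝ) : Prop :=
  DifferentiableAt ℝ (fun s => u s y t) x ∧
  DifferentiableAt ℝ (fun s => u x s t) y ∧
  DifferentiableAt ℝ (fun s => u x y s) t ∧
  DifferentiableAt ℝ (fun s => pdx u s y t) x ∧
  DifferentiableAt ℝ (fun s => pdy u x s t) y ∧
  DifferentiableAt ℝ (fun s => pdx u x s t) y ∧
  ContinuousAt (fun q : ℝ × ℝ × ℝ => u q.1 q.2.1 q.2.2) (x, y, t) ∧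
  ContinuousAt (fun q : ℝ × ℝ × ℝ => pdx u q.1 q.2.1 q.2.2) (x, y, t) ∧
  ContinuousAt (fun q : ℝ × ℝ × ℝ => pdy u q.1 q.2.1 q.2.2) (x, y, t) ∧
  ContinuousAt (fun q : ℝ × ℝ × ℝ => pdt u q.1 q.2.1 q.2.2) (x, y, t) ∧
  ContinuousAt (fun q : ℝ × ℝ × ℝ => pdxx u q.1 q.2.1 q.2.2) (x, y, t) ∧
  ContinuousAt (fun q : ℝ × ℝ × ℝ => pdyy u q.1 q.2.1 q.2.2) (x, y, t) ∧
  ContinuousAt (fun q : ℝ × ℝ × ℝ => pdxy u q.1 q.2.1 q.2.2) (x, y, t)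

/-- `u` is a nonnegative classical solution of `u_t - Δu = |∇u|^p` in
`Q_T = ω × (0,T)`, `ω = (-L,L) × (0,L)`, with `u = 0` on `Γ_T = (-L,L) × {0} × (0,T)`. -/
structure ClassicalSolution (p L T : ℝ) (u : ℝ → ℝ → ℝ → ℝ) : Prop where
  nonneg : ∀ ⦃x y t : ℝ⦄, |x| ≤ L → y ∈ Icc (0:ℝ) L → t ∈ Ioo 0 T → 0 ≤ u x y t
  smooth : ∀ ⦃x y t : ℝ⦄, |x| ≤ L → y ∈ Icc (0:ℝ) L → t ∈ Ioo 0 T → C21At u x y t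
  pde : ∀ ⦃x y t : ℝ⦄, |x| < L → y ∈ Ioo (0:ℝ) L → t ∈ Ioo 0 T →
    pdt u x y t - (pdxx u x y t + pdyy u x y t) = gradNorm u x y t ^ p
  bc : ∀ ⦃x t : ℝ⦄, |x| < L → t ∈ Ioo 0 T → u x 0 t = 0

/-- `u` has an isolated gradient blow-up point at `(0,0,T)`:
`limsup |∇u| = ∞` at `(0,0,T)` while `∇u` stays bounded on `K × (0,T)` for every
compact `K ⊆ ω̄ \ {(0,0)}`. -/
structure IsolatedGBU (L T : ℝ) (u : ℝ → ℝ → ℝ → ℝ) : Prop where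
  blowup : ∀ M : ℝ, ∀ δ > (0:ℝ), ∃ x y t : ℝ, |x| ≤ L ∧ y ∈ Icc (0:ℝ) L ∧
    t ∈ Ioo 0 T ∧ |x| < δ ∧ |y| < δ ∧ T - δ < t ∧ M < gradNorm u x y t
  bounded : ∀ K : Set (ℝ × ℝ), IsCompact K →
    K ⊆ (Icc (-L) L ×ˢ Icc (0:ℝ) L) \ {((0:ℝ), (0:ℝ))} →
    ∃ M : ℝ, ∀ q ∈ K, ∀ t ∈ Ioo (0:ℝ) T, gradNorm u q.1 q.2 t ≤ M

/-- `u` extends as a `C^{2,1}` function to `(ω̄' × [T/2,T]) \ {(0,0,T)}`,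
`ω' = (-L/2,L/2) × (0,L/2)`; values and derivatives at `t = T` refer to this extension. -/
def ExtC21 (L T : ℝ) (u : ℝ → ℝ → ℝ → ℝ) : Prop :=
  ∀ ⦃x y t : ℝ⦄, |x| ≤ L / 2 → y ∈ Icc (0:ℝ) (L / 2) → t ∈ Icc (T / 2) T →
    ¬(x = 0 ∧ y = 0 ∧ t = T) → C21At u x y t

/-- The monotonicity condition `x·u_x ≤ 0` in `Q_T`. -/
def MonCond (L T : ℝ) (u : ℝ → ℝ → ℝ → ℝ) : Prop :=
  ∀ ⦃x y t : ℝ⦄, |x| < L → y ∈ Ioo (0:ℝ) L → t ∈ Ioo 0 T → x * pdx u x y t ≤ 0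


lemma mvt_le {f f' : ℝ → ℝ} {a b c : ℝ} (hab : a ≤ b)
    (h : ∀ s ∈ Icc a b, HasDerivAt f (f' s) s) (hc : ∀ s ∈ Icc a b, f' s ≤ c) :
    f b - f a ≤ c * (b - a) := by
  refine Convex.image_sub_le_mul_sub_of_deriv_le (convex_Icc a b)
    (fun s hs => (h s hs).continuousAt.continuousWithinAt)
    (fun s hs => (h s (interior_subset hs)).differentiableAt.differentiableWithinAt)
    (fun s hs => ?_) a (left_mem_Icc.2 hab) b (right_mem_Icc.2 hab) hab
  rw [(h s (interior_subset hs)).deriv]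
  exact hc s (interior_subset hs)

lemma mvt_ge {f f' : ℝ → ℝ} {a b c : ℝ} (hab : a ≤ b)
    (h : ∀ s ∈ Icc a b, HasDerivAt f (f' s) s) (hc : ∀ s ∈ Icc a b, c ≤ f' s) :
    c * (b - a) ≤ f b - f a := by
  have := mvt_le (f := fun s => - f s) (f' := fun s => - f' s) (c := -c) hab
    (fun s hs => (h s hs).neg) (fun s hs => neg_le_neg (hc s hs))
  linarith

lemma young_tangent {p : ℝ} (hp : 2 < p) (q : ℝ) : p * q - (p - 1) ≤ |q| ^ p := by
  have h := one_add_mul_self_le_rpow_one_add (s := |q| - 1) (by linarith [abs_nonneg q])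
    (p := p) (by linarith)
  have h1 : 1 + (|q| - 1) = |q| := by ring
  rw [h1] at h
  nlinarith [le_abs_self q]

lemma exists_good {G : ℝ → ℝ → ℝ} (hG : Continuous (Function.uncurry G)) {x1 x2 Y c : ℝ}
    (hx : x1 < x2) (hY : 0 ≤ Y)
    (h : ∀ y ∈ Icc 0 Y, ∫ X in x1..x2, G X y ≤ c) :
    ∃ X ∈ Icc x1 x2, (x2 - x1) * ∫ y in (0:ℝ)..Y, G X y ≤ c * Y := by
  by_contra! hcon
  have hc1 : Continuous (fun X => ∫ y in (0:ℝ)..Y, G X y) :=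
    intervalIntegral.continuous_parametric_intervalIntegral_of_continuous' hG 0 Y
  have hG' : Continuous (Function.uncurry (fun y X => G X y)) := by
    have := hG.comp (continuous_swap (X := ℝ) (Y := ℝ))
    exact this
  have hc2 : Continuous (fun y => ∫ X in x1..x2, G X y) :=
    intervalIntegral.continuous_parametric_intervalIntegral_of_continuous' hG' x1 x2
  have h1 : ∫ X in x1..x2, (c * Y / (x2 - x1)) < ∫ X in x1..x2, ∫ y in (0:ℝ)..Y, G X y := by
    have key : ∀ X ∈ Icc x1 x2, c * Y / (x2 - x1) < ∫ y in (0:ℝ)..Y, G X y := by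
      intro X hX
      rw [div_lt_iff₀ (by linarith)]
      linarith [hcon X hX]
    refine intervalIntegral.integral_lt_integral_of_continuousOn_of_le_of_exists_lt hx
      continuousOn_const hc1.continuousOn (fun X hX => (key X (Ioc_subset_Icc_self hX)).le)
      ⟨x1, left_mem_Icc.2 hx.le, key _ (left_mem_Icc.2 hx.le)⟩
  have h2 : ∫ y in (0:ℝ)..Y, ∫ X in x1..x2, G X y ≤ ∫ y in (0:ℝ)..Y, c :=
    intervalIntegral.integral_mono_on hY (hc2.intervalIntegrable _ _) (by simp) h
  have h3 : ∫ X in x1..x2, ∫ y in (0:ℝ)..Y, G X y = ∫ y in (0:ℝ)..Y, ∫ X in x1..x2, G X y := by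
    simp_rw [intervalIntegral.integral_of_le hY]
    refine intervalIntegral_integral_swap ?_
    rw [uIoc_of_le hx.le, Measure.prod_restrict]
    have : IntegrableOn (Function.uncurry G) (Icc x1 x2 ×ˢ Icc 0 Y) (volume.prod volume) :=
      hG.continuousOn.integrableOn_compact (isCompact_Icc.prod isCompact_Icc)
    exact this.mono_set (prod_mono Ioc_subset_Icc_self Ioc_subset_Icc_self)
  rw [h3] at h1
  simp only [intervalIntegral.integral_const, smul_eq_mul] at h1 h2
  have h4 : (x2 - x1) * (c * Y / (x2 - x1)) = c * Y := by
    field_simp [(sub_pos.2 hx).ne']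
  rw [h4] at h1
  linarith

/-- Time-slice data on `(0,δ] × [0,δ]`. -/
structure Prof (p C δ : ℝ) (v vx vy vxx vyy : ℝ → ℝ → ℝ) : Prop where
  dx : ∀ X y, 0 < X → X ≤ δ → 0 ≤ y → y ≤ δ → HasDerivAt (fun s => v s y) (vx X y) X
  dy : ∀ X y, 0 < X → X ≤ δ → 0 ≤ y → y ≤ δ → HasDerivAt (fun s => v X s) (vy X y) y
  dxx : ∀ X y, 0 < X → X ≤ δ → 0 ≤ y → y ≤ δ → HasDerivAt (fun s => vx s y) (vxx X y) X
  dyy : ∀ X y, 0 < X → X ≤ δ → 0 ≤ y → y ≤ δ → HasDerivAt (fun s => vy X s) (vyy X y) y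
  cxx : ∀ X y, 0 < X → X ≤ δ → 0 ≤ y → y ≤ δ →
    ContinuousAt (fun q : ℝ × ℝ => vxx q.1 q.2) (X, y)
  eq : ∀ X y, 0 < X → X ≤ δ → 0 ≤ y → y ≤ δ →
    |vyy X y + vxx X y + Real.sqrt (vx X y ^ 2 + vy X y ^ 2) ^ p| ≤ C
  xxlow : ∀ X y, 0 < X → X ≤ δ → 0 ≤ y → y ≤ δ → -C ≤ vxx X y
  xlow : ∀ X y, 0 < X → X ≤ δ → 0 ≤ y → y ≤ δ → -(C * X) ≤ vx X y
  xup : ∀ X y, 0 < X → X ≤ δ → 0 ≤ y → y ≤ δ → vx X y ≤ 0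
  ylow : ∀ X y, 0 < X → X ≤ δ → 0 ≤ y → y ≤ δ → -C ≤ vy X y
  zero : ∀ X, 0 < X → X ≤ δ → v X 0 = 0

section prof
variable {p C δ : ℝ} {v vx vy vxx vyy : ℝ → ℝ → ℝ}

lemma Prof.anti (h : Prof p C δ v vx vy vxx vyy) {x X y : ℝ} (hx : 0 < x) (hxX : x ≤ X)
    (hX : X ≤ δ) (hy : 0 ≤ y) (hy' : y ≤ δ) : v X y ≤ v x y := by
  have := mvt_le (f := fun s => v s y) (f' := fun s => vx s y) (c := 0) hxX
    (fun s hs => h.dx s y (by linarith [hs.1]) (by linarith [hs.2]) hy hy')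
    (fun s hs => h.xup s y (by linarith [hs.1]) (by linarith [hs.2]) hy hy')
  linarith

lemma deriv_nonneg_of_right {f : ℝ → ℝ} {f' r : ℝ} (hr : 0 < r) (hf : HasDerivAt f f' 0)
    (h0 : f 0 = 0) (hpos : ∀ y ∈ Icc 0 r, 0 ≤ f y) : 0 ≤ f' := by
  have h1 := hf.hasDerivWithinAt (s := Ioi 0)
  rw [hasDerivWithinAt_iff_tendsto_slope' (by simp)] at h1
  refine ge_of_tendsto h1 ?_
  filter_upwards [Ioo_mem_nhdsGT hr] with y hy
  rw [slope_def_field, h0]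
  have := hpos y ⟨hy.1.le, hy.2.le⟩
  have := hy.1
  positivity

lemma Prof.bd_anti (h : Prof p C δ v vx vy vxx vyy) {x X : ℝ} (hδ : 0 < δ) (hx : 0 < x)
    (hxX : x ≤ X) (hX : X ≤ δ) : vy X 0 ≤ vy x 0 := by
  have h1 := (h.dy x 0 hx (by linarith) le_rfl hδ.le).sub
    (h.dy X 0 (by linarith) hX le_rfl hδ.le)
  have := deriv_nonneg_of_right hδ h1 (by
    simp [h.zero x hx (by linarith), h.zero X (by linarith) hX])
    (fun y hy => by
      have := h.anti hx hxX hX hy.1 hy.2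
      simp only [Pi.sub_apply]; linarith)
  linarith

/-- good abscissa -/
lemma Prof.good (h : Prof p C δ v vx vy vxx vyy) (hC : 0 < C) (hδ1 : δ ≤ 1)
    {ε x Y : ℝ} (hε : 0 < ε) (hε1 : ε < 1)
    (hx : 0 < x) (hx2 : x ≤ δ / 2) (hY : 0 < Y) (hYδ : Y ≤ δ) :
    ∃ X ∈ Icc x (x + ε * x * Y), ∃ H : ℝ → ℝ,
      H 0 = 0 ∧ (∀ y ∈ Icc 0 Y, HasDerivAt H (vxx X y + C) y) ∧
      ∀ y ∈ Icc 0 Y, 0 ≤ H y ∧ H y ≤ 2 * C / ε := by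
  set η := ε * x * Y with hη
  have hη0 : 0 < η := by positivity
  have hηx : η ≤ x := by
    have h1 : ε * Y ≤ 1 := by nlinarith
    have : η = x * (ε * Y) := by rw [hη]; ring
    nlinarith
  have hin : ∀ X ∈ Icc x (x + η), 0 < X ∧ X ≤ δ := fun X hX =>
    ⟨by linarith [hX.1], by linarith [hX.2]⟩
  set pX : ℝ → ℝ := fun X => max x (min X (x + η)) with hpX
  set pY : ℝ → ℝ := fun y => max 0 (min y Y) with hpY
  have hpXm : ∀ X, pX X ∈ Icc x (x + η) := fun X =>
    ⟨le_max_left _ _, max_le (by linarith) (min_le_right _ _)⟩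
  have hpYm : ∀ y, pY y ∈ Icc 0 Y := fun y =>
    ⟨le_max_left _ _, max_le (by linarith) (min_le_right _ _)⟩
  have hpXe : ∀ X ∈ Icc x (x + η), pX X = X := fun X hX => by
    simp only [hpX]; rw [min_eq_left hX.2, max_eq_right hX.1]
  have hpYe : ∀ y ∈ Icc 0 Y, pY y = y := fun y hX => by
    simp only [hpY]; rw [min_eq_left hX.2, max_eq_right hX.1]
  set G : ℝ → ℝ → ℝ := fun X y => vxx (pX X) (pY y) + C with hG
  have hGc : Continuous (Function.uncurry G) := by
    rw [continuous_iff_continuousAt]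
    rintro ⟨X, y⟩
    have hm1 := hpXm X
    have hm2 := hpYm y
    have h1 := h.cxx (pX X) (pY y) (hin _ hm1).1 (hin _ hm1).2 hm2.1 (by linarith [hm2.2])
    have h2 : ContinuousAt (fun q : ℝ × ℝ => (pX q.1, pY q.2)) (X, y) := by
      apply Continuous.continuousAt
      simp only [hpX, hpY]; fun_prop
    exact (ContinuousAt.comp (x := (X, y)) (f := fun q : ℝ × ℝ => (pX q.1, pY q.2)) h1 h2).add
      continuousAt_const
  have hGn : ∀ X y, 0 ≤ G X y := fun X y => by
    have hm1 := hpXm X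
    have hm2 := hpYm y
    have := h.xxlow (pX X) (pY y) (hin _ hm1).1 (hin _ hm1).2 hm2.1 (by linarith [hm2.2])
    simp only [hG]; linarith
  obtain ⟨X, hX, hXi⟩ := exists_good hGc (x1 := x) (x2 := x + η) (Y := Y) (c := C * x + C * η)
    (by linarith) hY.le (by
      intro y hy
      have hd : ∀ s ∈ uIcc x (x + η), HasDerivAt (fun s => vx s y + C * s) (G s y) s := by
        intro s hs
        rw [uIcc_of_le (by linarith)] at hs
        simp only [hG]
        rw [hpXe s hs, hpYe y hy]
        have := (h.dxx s y (hin s hs).1 (hin s hs).2 hy.1 (by linarith [hy.2])).fun_add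
          ((hasDerivAt_id s).const_mul C)
        rw [mul_one] at this
        exact this
      rw [intervalIntegral.integral_eq_sub_of_hasDerivAt hd
        ((hGc.comp (by fun_prop : Continuous (fun s : ℝ => (s, y)))).intervalIntegrable _ _)]
      have e1 := h.xup (x + η) y (by linarith) (by linarith) hy.1 (by linarith [hy.2])
      have e2 := h.xlow x y hx (by linarith) hy.1 (by linarith [hy.2])
      linarith)
  have hGX : Continuous (G X) := hGc.comp (by fun_prop : Continuous (fun s : ℝ => (X, s)))
  refine ⟨X, hX, fun y => ∫ s in (0:ℝ)..y, G X s, by simp, ?_, ?_⟩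
  · intro y hy
    have := intervalIntegral.integral_hasDerivAt_right (hGX.intervalIntegrable 0 y)
      (hGX.stronglyMeasurableAtFilter _ _) hGX.continuousAt
    have e : G X y = vxx X y + C := by simp only [hG]; rw [hpXe X hX, hpYe y hy]
    rwa [e] at this
  · intro y hy
    refine ⟨intervalIntegral.integral_nonneg hy.1 (fun s _ => hGn X s), ?_⟩
    have e1 : ∫ s in (0:ℝ)..y, G X s ≤ ∫ s in (0:ℝ)..Y, G X s :=
      intervalIntegral.integral_mono_interval le_rfl hy.1 hy.2
        (Filter.Eventually.of_forall (fun s => hGn X s)) (hGX.intervalIntegrable _ _)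
    refine e1.trans ?_
    have e2 : (x + η - x) = ε * x * Y := by rw [hη]; ring
    rw [e2] at hXi
    rw [le_div_iff₀ hε]
    have e3 : (x * Y) * ((∫ s in (0:ℝ)..Y, G X s) * ε) ≤ (x * Y) * (2 * C) := by
      have : C * η * Y ≤ C * x * Y := by gcongr
      nlinarith
    exact le_of_mul_le_mul_left e3 (by positivity)

end prof

set_option maxHeartbeats 1600000 in
theorem prof_key {p C δ ε : ℝ} (hp : 2 < p) (hC : 1 ≤ C) (hδ : 0 < δ) (hδ1 : δ ≤ 1)
    (hε : 0 < ε) (hε1 : ε < 1) : ∃ K : ℝ, 0 < K ∧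
    ∀ v vx vy vxx vyy : ℝ → ℝ → ℝ, Prof p C δ v vx vy vxx vyy →
      ∀ x y0 : ℝ, 0 < x → x ≤ δ / 2 → 0 ≤ y0 → y0 ≤ δ / 2 → 0 < vy ((1 + ε) * x) 0 →
      ((vy ((1 + ε) * x) 0) ^ (1 - p) + (p - 1) * y0) ^ (-(1 / (p - 1))) - K ≤ vy x y0 := by
  have hp1 : 0 < p - 1 := by linarith
  obtain ⟨β, hβ⟩ : ∃ β, β = 1 / (p - 1) := ⟨_, rfl⟩
  have hβ0 : 0 < β := by rw [hβ]; positivity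
  have hβ1 : β < 1 := by rw [hβ, div_lt_one hp1]; linarith
  have hβp : (p - 1) * β = 1 := by rw [hβ]; field_simp
  have hβp' : p * β = 1 + β := by linarith
  set C2 : ℝ := C + 2 * C / ε + 1 with hC2
  have hC20 : 0 < C2 := by positivity
  set b : ℝ := min (δ / 2) ((1 / 2) * (2 * C) ^ (-(p - 1))) with hb
  have hb0 : 0 < b := lt_min (by linarith) (by positivity)
  have hbβ : 0 < b ^ (-β) := by positivity
  refine ⟨b ^ (-β) + C + 4 * (8 * C + C2) + 1, by positivity, ?_⟩
  intro v vx vy vxx vyy h x y0 hx hx2 hy0 hy02 hm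
  rw [← hβ]
  set K := b ^ (-β) + C + 4 * (8 * C + C2) + 1 with hK
  set m := vy ((1 + ε) * x) 0 with hmdef
  set a : ℝ := m ^ (1 - p) with ha
  have ha0 : 0 < a := by positivity
  have hBpos : ∀ y, 0 ≤ y → 0 < a + (p - 1) * y := fun y hy => by positivity
  set B0 := a + (p - 1) * y0 with hB0
  have hB0p : 0 < B0 := hBpos y0 hy0
  have hxδ : x ≤ δ := by linarith
  rcases le_or_gt b B0 with hcase | hcase
  · have h1 : B0 ^ (-β) ≤ b ^ (-β) := Real.rpow_le_rpow_of_nonpos hb0 hcase (by linarith)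
    have h2 := h.ylow x y0 hx hxδ hy0 (by linarith)
    linarith
  by_contra! hcon
  set ℓ := B0 / (p - 1) with hℓ
  have hℓ0 : 0 < ℓ := by positivity
  have hℓB : (p - 1) * ℓ = B0 := by rw [hℓ]; field_simp
  have hℓB' : ℓ ≤ B0 := by
    rw [← hℓB]; exact le_mul_of_one_le_left hℓ0.le (by linarith)
  have hy0ℓ : y0 ≤ ℓ := by
    have : (p - 1) * y0 ≤ (p - 1) * ℓ := by linarith
    exact le_of_mul_le_mul_left this hp1
  have hbδ : b ≤ δ / 2 := min_le_left _ _
  have hbC : b ≤ (1 / 2) * (2 * C) ^ (-(p - 1)) := min_le_right _ _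
  set Y := y0 + ℓ with hY
  have hYδ : Y ≤ δ := by linarith
  have hY0 : 0 < Y := by linarith
  have hBY : a + (p - 1) * Y = 2 * B0 := by rw [hY]; linarith
  have hBle : ∀ y, y ≤ Y → a + (p - 1) * y ≤ 2 * B0 := fun y hy => by
    rw [← hBY]; linarith [mul_le_mul_of_nonneg_left hy hp1.le]
  have hBder : ∀ y, HasDerivAt (fun s => a + (p - 1) * s) (p - 1) y := fun y => by
    have := ((hasDerivAt_id y).const_mul (p - 1)).const_add a
    rw [mul_one] at this
    exact this
  have hpow4 : (2 * B0) ^ (1 + β) ≤ 4 * B0 ^ (1 + β) := by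
    rw [Real.mul_rpow (by norm_num) hB0p.le]
    have : (2:ℝ) ^ (1 + β) ≤ 2 ^ (2:ℝ) := Real.rpow_le_rpow_of_exponent_le (by norm_num) (by linarith)
    have h2 : (2:ℝ) ^ (2:ℝ) = 4 := by norm_num
    rw [h2] at this
    gcongr
  -- step 1
  have step1 : ∀ y ∈ Icc y0 Y, K / 4 - 2 * C ≤ (a + (p - 1) * y) ^ (-β) - vy x y := by
    intro y hy
    have hmono := mvt_ge (a := y0) (b := y) (c := 0)
      (f := fun s => (a + (p - 1) * s) - vy x s * (a + (p - 1) * s) ^ (1 + β)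
        + 2 * C * (2 * B0) ^ (1 + β) * s)
      (f' := fun s => (p - 1) - (vyy x s * (a + (p - 1) * s) ^ (1 + β)
        + vy x s * ((p - 1) * (1 + β) * (a + (p - 1) * s) ^ (1 + β - 1)))
        + 2 * C * (2 * B0) ^ (1 + β)) hy.1
      (fun s hs => by
        have hs0 : 0 ≤ s := by linarith [hs.1]
        have d1 := h.dyy x s hx hxδ hs0 (by linarith [hs.2, hy.2])
        have d2 := (hBder s).rpow_const (p := 1 + β) (Or.inl (hBpos s hs0).ne')
        have d3 := (hasDerivAt_id s).const_mul (2 * C * (2 * B0) ^ (1 + β))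
        rw [mul_one] at d3
        exact ((hBder s).fun_sub (d1.fun_mul d2)).fun_add d3)
      (fun s hs => by
        have hs0 : 0 ≤ s := by linarith [hs.1]
        have hsY : s ≤ Y := by linarith [hs.2, hy.2]
        set B := a + (p - 1) * s with hB
        have hBp : 0 < B := hBpos s hs0
        have e1 := (abs_le.1 (h.eq x s hx hxδ hs0 (by linarith))).2
        have e2 := h.xxlow x s hx hxδ hs0 (by linarith)
        have e3 : |vy x s| ^ p ≤ Real.sqrt (vx x s ^ 2 + vy x s ^ 2) ^ p := by
          apply Real.rpow_le_rpow (abs_nonneg _) _ (by linarith)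
          apply Real.abs_le_sqrt
          linarith [sq_nonneg (vx x s)]
        have e4 : vyy x s ≤ 2 * C - |vy x s| ^ p := by linarith
        have e5 : (p - 1) * (1 + β) = p := by linarith
        have e6 : 1 + β - 1 = β := by ring
        rw [e5, e6]
        have e7 := young_tangent hp (vy x s * B ^ β)
        have e8 : |vy x s * B ^ β| ^ p = |vy x s| ^ p * B ^ (1 + β) := by
          rw [abs_mul, abs_of_pos (Real.rpow_pos_of_pos hBp β),
            Real.mul_rpow (abs_nonneg _) (by positivity), ← Real.rpow_mul hBp.le, mul_comm β p,
            hβp']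
        rw [e8] at e7
        have e9 : B ^ (1 + β) ≤ (2 * B0) ^ (1 + β) :=
          Real.rpow_le_rpow hBp.le (hBle s hsY) (by linarith)
        have e10 : 0 < B ^ (1 + β) := by positivity
        have e11 : vyy x s * B ^ (1 + β) ≤ (2 * C - |vy x s| ^ p) * B ^ (1 + β) := by gcongr
        have e12 : 2 * C * B ^ (1 + β) ≤ 2 * C * (2 * B0) ^ (1 + β) := by gcongr
        linarith)
    have hy0' : 0 ≤ y := by linarith [hy.1]
    have hBy := hBpos y hy0'
    have hfac : ∀ B : ℝ, 0 < B → B ^ (1 + β) * B ^ (-β) = B := fun B hB => by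
      rw [← Real.rpow_add hB]; simp
    have f0 := hfac B0 hB0p
    have f1 := hfac _ hBy
    set B := a + (p - 1) * y with hB
    have g1 : 0 < B ^ (1 + β) := by positivity
    have g0 : 0 < B0 ^ (1 + β) := by positivity
    have g2 : B ^ (1 + β) ≤ 4 * B0 ^ (1 + β) :=
      (Real.rpow_le_rpow hBy.le (hBle y hy.2) (by linarith)).trans hpow4
    have g3 : B0 ^ (1 + β) * (B0 ^ (-β) - vy x y0) ≥ B0 ^ (1 + β) * K := by
      apply mul_le_mul_of_nonneg_left _ g0.le; linarith
    have g4 : 2 * C * (2 * B0) ^ (1 + β) * (y - y0) ≤ 8 * C * B0 ^ (1 + β) := by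
      have : y - y0 ≤ 1 := by linarith [hy.2]
      have h1 : 2 * C * (2 * B0) ^ (1 + β) * (y - y0) ≤ 2 * C * (2 * B0) ^ (1 + β) * 1 := by
        gcongr
      linarith [mul_le_mul_of_nonneg_left hpow4 (by linarith : 0 ≤ 2 * C)]
    have g5 : (K - 8 * C) * B0 ^ (1 + β) ≤ B ^ (1 + β) * (B ^ (-β) - vy x y) := by
      have := hmono
      simp only [zero_mul] at this
      rw [← hB0] at this
      linarith
    have g6 : 0 ≤ K - 8 * C := by
      rw [hK]; linarith
    have g7 : (K - 8 * C) / 4 * B ^ (1 + β) ≤ B ^ (1 + β) * (B ^ (-β) - vy x y) := by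
      linarith [mul_le_mul_of_nonneg_left g2 (by linarith : 0 ≤ (K - 8 * C) / 4)]
    have g8 : (K - 8 * C) / 4 ≤ B ^ (-β) - vy x y := by
      rw [mul_comm] at g7
      exact le_of_mul_le_mul_left g7 g1
    linarith
  -- step 2
  obtain ⟨X, hX, H, hH0, hHd, hHb⟩ := h.good (by linarith) hδ1 hε hε1 hx hx2 hY0 hYδ
  have hY1 : Y ≤ 1 := by linarith
  have hη : ε * x * Y ≤ ε * x := by
    have : 0 < ε * x := by positivity
    linarith [mul_le_mul_of_nonneg_left hY1 this.le]
  have hX0 : 0 < X := by linarith [hX.1]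
  have hlamδ : (1 + ε) * x ≤ δ := by
    linarith [mul_le_mul_of_nonneg_right hε1.le hx.le]
  have hXlam : X ≤ (1 + ε) * x := by linarith [hX.2]
  have hXδ : X ≤ δ := by linarith
  have step2 : ∀ y ∈ Icc 0 Y, (a + (p - 1) * y) ^ (-β) ≤ vy X y + C + H y + y := by
    have hFder : ∀ y, 0 ≤ y → HasDerivAt (fun s => (a + (p - 1) * s) ^ (-β))
        ((p - 1) * (-β) * (a + (p - 1) * y) ^ (-β - 1)) y := fun y hy =>
      (hBder y).rpow_const (Or.inl (hBpos y hy).ne')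
    have hGder : ∀ y ∈ Icc 0 Y, HasDerivAt (fun s => vy X s + C + H s + s)
        (vyy X y + (vxx X y + C) + 1) y := fun y hy =>
      (((h.dyy X y hX0 hXδ hy.1 (by linarith [hy.2])).add_const C).fun_add (hHd y hy)).fun_add
        (hasDerivAt_id y)
    refine image_le_of_deriv_right_lt_deriv_boundary' (a := 0) (b := Y)
      (f := fun s => (a + (p - 1) * s) ^ (-β)) (B := fun s => vy X s + C + H s + s)
      (fun y hy => (hFder y hy.1).continuousAt.continuousWithinAt)
      (fun y hy => (hFder y hy.1).hasDerivWithinAt) ?_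
      (fun y hy => (hGder y hy).continuousAt.continuousWithinAt)
      (fun y hy => (hGder y (Ico_subset_Icc_self hy)).hasDerivWithinAt) ?_
    · simp only [mul_zero, add_zero, hH0]
      have e1 : a ^ (-β) = m := by
        rw [ha, ← Real.rpow_mul hm.le]
        have : (1 - p) * -β = 1 := by linarith
        rw [this, Real.rpow_one]
      rw [e1]
      have := h.bd_anti hδ hX0 hXlam hlamδ
      linarith
    · intro y hy heq
      have hyI := Ico_subset_Icc_self hy
      have hyδ : y ≤ δ := by linarith [hy.2]
      set B := a + (p - 1) * y with hB
      have hBp : 0 < B := hBpos y hy.1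
      have e0 : (p - 1) * -β * B ^ (-β - 1) = -((B ^ (-β)) ^ p) := by
        rw [← Real.rpow_mul hBp.le]
        have e1 : -β * p = -β - 1 := by linarith
        have e2 : (p - 1) * -β = -1 := by linarith
        rw [e1, e2]; ring
      rw [e0]
      have e1 := (abs_le.1 (h.eq X y hX0 hXδ hy.1 hyδ)).1
      have e2 : Real.sqrt (vx X y ^ 2 + vy X y ^ 2) ≤ C + |vy X y| := by
        have l1 := h.xlow X y hX0 hXδ hy.1 hyδ
        have l2 := h.xup X y hX0 hXδ hy.1 hyδ
        have l3 : |vx X y| ≤ C := by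
          have l4 : C * X ≤ C * 1 :=
            mul_le_mul_of_nonneg_left (by linarith) (by linarith)
          rw [abs_le]; constructor <;> linarith
        rw [Real.sqrt_le_left (by positivity)]
        have l4 : |vx X y| ^ 2 ≤ C ^ 2 := pow_le_pow_left₀ (abs_nonneg _) l3 2
        have l5 : 0 ≤ C * |vy X y| := by positivity
        have l6 : (C + |vy X y|) ^ 2 = C ^ 2 + 2 * (C * |vy X y|) + |vy X y| ^ 2 := by ring
        rw [← sq_abs (vx X y), ← sq_abs (vy X y), l6]
        linarith
      have e3 : Real.sqrt (vx X y ^ 2 + vy X y ^ 2) ≤ B ^ (-β) := by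
        refine e2.trans ?_
        have hHy := (hHb y hyI).1
        rcases le_total 0 (vy X y) with hs | hs
        · rw [abs_of_nonneg hs]; linarith [hy.1]
        · rw [abs_of_nonpos hs]
          have l1 := h.ylow X y hX0 hXδ hy.1 hyδ
          have l2 : (2 * B0) ≤ (2 * C) ^ (-(p - 1)) := by linarith
          have l3 : ((2 * C) ^ (-(p - 1))) ^ (-β) ≤ B ^ (-β) :=
            Real.rpow_le_rpow_of_nonpos hBp ((hBle y hyI.2).trans l2) (by linarith)
          rw [← Real.rpow_mul (by positivity)] at l3
          have l4 : -(p - 1) * -β = 1 := by linarith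
          rw [l4, Real.rpow_one] at l3
          linarith
      have e4 : Real.sqrt (vx X y ^ 2 + vy X y ^ 2) ^ p ≤ (B ^ (-β)) ^ p :=
        Real.rpow_le_rpow (Real.sqrt_nonneg _) e3 (by linarith)
      linarith
  -- step 3
  have hE := mvt_le (a := y0) (b := Y) (c := -(K / 4 - 2 * C - C2))
    (f := fun s => v x s - v X s) (f' := fun s => vy x s - vy X s) (by linarith)
    (fun s hs => (h.dy x s hx hxδ (by linarith [hs.1]) (by linarith [hs.2])).fun_sub
      (h.dy X s hX0 hXδ (by linarith [hs.1]) (by linarith [hs.2])))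
    (fun s hs => by
      have h1 := step1 s hs
      have hsI : s ∈ Icc 0 Y := ⟨by linarith [hs.1], hs.2⟩
      have h2 := step2 s hsI
      have h3 := (hHb s hsI).2
      have h4 : s ≤ 1 := by linarith [hs.2]
      simp only [hC2]
      linarith)
  have hE1 : 0 ≤ v x Y - v X Y := by
    linarith [h.anti hx hX.1 hXδ hY0.le hYδ]
  have hE2 : v x y0 - v X y0 ≤ 2 * C * Y := by
    have := mvt_ge (f := fun s => v s y0) (f' := fun s => vx s y0) (c := -C) hX.1
      (fun s hs => h.dx s y0 (by linarith [hs.1]) (by linarith [hs.2]) hy0 (by linarith))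
      (fun s hs => by
        have := h.xlow s y0 (by linarith [hs.1]) (by linarith [hs.2]) hy0 (by linarith)
        have hs1 : s ≤ 1 := by linarith [hs.2]
        linarith [mul_le_mul_of_nonneg_left hs1 (by linarith : 0 ≤ C)])
    have h2 : X - x ≤ Y := by
      have h3 : ε * x ≤ 1 := mul_le_one₀ hε1.le hx.le (by linarith)
      linarith [hX.2, mul_le_mul_of_nonneg_right h3 hY0.le]
    have h4 : C * (X - x) ≤ C * Y := mul_le_mul_of_nonneg_left h2 (by linarith)
    have h5 : 0 ≤ C * Y := by positivity
    linarith
  have hE3 : Y - y0 = ℓ := by rw [hY]; ring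
  rw [hE3] at hE
  have hYℓ : Y ≤ 2 * ℓ := by linarith
  have hfin : (K / 4 - 2 * C - C2) * ℓ ≤ 4 * C * ℓ := by
    linarith [mul_le_mul_of_nonneg_left hYℓ (by linarith : 0 ≤ 2 * C)]
  have := le_of_mul_le_mul_right hfin hℓ0
  rw [hK] at this
  linarith

lemma maxprin {f : ℝ → ℝ → ℝ → ℝ} {x1 x2 y1 y2 t0 t1 M : ℝ}
    (hc : ContinuousOn (fun q : ℝ × ℝ × ℝ => f q.1 q.2.1 q.2.2)
      (Icc x1 x2 ×ˢ Icc y1 y2 ×ˢ Icc t0 t1))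
    (hint : ∀ x ∈ Ioo x1 x2, ∀ y ∈ Ioo y1 y2, ∀ t ∈ Ioc t0 t1,
      IsLocalMax (fun s => f s y t) x → IsLocalMax (fun s => f x s t) y →
      ∃ d ≤ 0, HasDerivAt (fun s => f x y s) d t)
    (hbd : ∀ x ∈ Icc x1 x2, ∀ y ∈ Icc y1 y2, ∀ t ∈ Icc t0 t1,
      (x = x1 ∨ x = x2 ∨ y = y1 ∨ y = y2 ∨ t = t0) → f x y t ≤ M) :
    ∀ x ∈ Icc x1 x2, ∀ y ∈ Icc y1 y2, ∀ t ∈ Icc t0 t1, f x y t ≤ M := by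
  intro x hx y hy t ht
  have main : ∀ δ > 0, f x y t ≤ M + δ * (t - t0) := by
    intro δ hδ
    have hcomp : IsCompact (Icc x1 x2 ×ˢ Icc y1 y2 ×ˢ Icc t0 t1) :=
      isCompact_Icc.prod (isCompact_Icc.prod isCompact_Icc)
    obtain ⟨⟨a, b, c⟩, hmem, hmax⟩ := hcomp.exists_isMaxOn ⟨(x, y, t), hx, hy, ht⟩
      (f := fun q : ℝ × ℝ × ℝ => f q.1 q.2.1 q.2.2 - δ * (q.2.2 - t0))
      (hc.sub (by fun_prop))
    obtain ⟨ha, hb, hcc⟩ := hmem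
    simp only at ha hb hcc
    have hmax' : ∀ x' ∈ Icc x1 x2, ∀ y' ∈ Icc y1 y2, ∀ t' ∈ Icc t0 t1,
        f x' y' t' - δ * (t' - t0) ≤ f a b c - δ * (c - t0) := fun x' h1 y' h2 t' h3 =>
      hmax (show (x', y', t') ∈ _ from ⟨h1, h2, h3⟩)
    have h1 := hmax' x hx y hy t ht
    by_cases hB : a = x1 ∨ a = x2 ∨ b = y1 ∨ b = y2 ∨ c = t0
    · have h2 := hbd a ha b hb c hcc hB
      have : 0 ≤ δ * (c - t0) := mul_nonneg hδ.le (by linarith [hcc.1])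
      linarith
    · exfalso
      simp only [not_or] at hB
      obtain ⟨n1, n2, n3, n4, n5⟩ := hB
      have ha' : a ∈ Ioo x1 x2 := ⟨lt_of_le_of_ne ha.1 (Ne.symm n1), lt_of_le_of_ne ha.2 n2⟩
      have hb' : b ∈ Ioo y1 y2 := ⟨lt_of_le_of_ne hb.1 (Ne.symm n3), lt_of_le_of_ne hb.2 n4⟩
      have hc' : c ∈ Ioc t0 t1 := ⟨lt_of_le_of_ne hcc.1 (Ne.symm n5), hcc.2⟩
      obtain ⟨d, hd, hder⟩ := hint a ha' b hb' c hc'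
        (by
          filter_upwards [Ioo_mem_nhds ha'.1 ha'.2] with s hs
          have := hmax' s (Ioo_subset_Icc_self hs) b hb c hcc
          linarith)
        (by
          filter_upwards [Ioo_mem_nhds hb'.1 hb'.2] with s hs
          have := hmax' a ha s (Ioo_subset_Icc_self hs) c hcc
          linarith)
      have h2 := hder.hasDerivWithinAt (s := Iio c)
      rw [hasDerivWithinAt_iff_tendsto_slope' (by simp)] at h2
      have : δ ≤ d := by
        refine ge_of_tendsto h2 ?_
        filter_upwards [Ioo_mem_nhdsLT hc'.1] with s hs
        have h3 := hmax' a ha b hb s ⟨hs.1.le, hs.2.le.trans hcc.2⟩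
        rw [slope_comm, slope_def_field, le_div_iff₀ (by linarith [hs.2])]
        linarith
      linarith
  by_contra! hlt
  have ht0 : t0 ≤ t := ht.1
  have h1 := main ((f x y t - M) / (2 * (t - t0 + 1))) (by
    apply div_pos <;> linarith)
  have h2 : (f x y t - M) / (2 * (t - t0 + 1)) * (t - t0) ≤ (f x y t - M) / 2 := by
    rw [div_mul_eq_mul_div, div_le_div_iff₀ (by linarith) (by norm_num)]
    nlinarith
  linarith

lemma localmax_second {g g' : ℝ → ℝ} {x d : ℝ} (hg : ∀ᶠ s in nhds x, HasDerivAt g (g' s) s)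
    (hd : HasDerivAt g' d x) (hmax : IsLocalMax g x) : g' x = 0 ∧ d ≤ 0 := by
  have h0 : g' x = 0 := hmax.hasDerivAt_eq_zero hg.self_of_nhds
  refine ⟨h0, ?_⟩
  by_contra! hpos
  have he : deriv g =ᶠ[nhds x] g' := hg.mono (fun s hs => hs.deriv)
  have hmin : IsLocalMin g x := by
    apply isLocalMin_of_deriv_deriv_pos
    · rw [he.deriv_eq, hd.deriv]; exact hpos
    · rw [he.self_of_nhds, h0]
    · exact hg.self_of_nhds.continuousAt
  have hconst : g =ᶠ[nhds x] fun _ => g x := by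
    filter_upwards [hmin, hmax] with s h1 h2
    exact le_antisymm h2 h1
  have h2 : deriv g =ᶠ[nhds x] fun _ => 0 := by
    have := hconst.deriv
    simpa using this
  have h3 : g' =ᶠ[nhds x] fun _ => 0 := he.symm.trans h2
  have := h3.deriv_eq
  rw [hd.deriv] at this
  simp at this
  linarith

lemma second_diff {g g' g'' : ℝ → ℝ} {x h C : ℝ} (hh : 0 ≤ h)
    (h1 : ∀ s ∈ Icc (x - h) (x + h), HasDerivAt g (g' s) s)
    (h2 : ∀ s ∈ Icc (x - h) (x + h), HasDerivAt g' (g'' s) s)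
    (h3 : ∀ s ∈ Icc (x - h) (x + h), -C ≤ g'' s) :
    2 * g x - g (x + h) - g (x - h) ≤ C * h ^ 2 := by
  have := mvt_ge (f := fun s => g (x + s) + g (x - s) + C * s ^ 2)
    (f' := fun s => g' (x + s) + -g' (x - s) + C * (2 * s)) (c := 0) hh
    (fun s hs => by
      have d1 : HasDerivAt (fun s => g (x + s)) (g' (x + s)) s :=
        (h1 (x + s) ⟨by linarith [hs.1], by linarith [hs.2]⟩).comp_const_add x s
      have d2 : HasDerivAt (fun s => g (x - s)) (-g' (x - s)) s :=
        (h1 (x - s) ⟨by linarith [hs.2], by linarith [hs.1]⟩).comp_const_sub x s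
      have d3 : HasDerivAt (fun s : ℝ => C * s ^ 2) (C * (2 * s)) s := by
        have := (hasDerivAt_pow 2 s).const_mul C
        simpa using this
      exact (d1.fun_add d2).fun_add d3)
    (fun s hs => by
      have := mvt_ge (f := g') (f' := g'') (a := x - s) (b := x + s) (c := -C)
        (by linarith [hs.1])
        (fun r hr => h2 r ⟨by linarith [hr.1, hs.2], by linarith [hr.2, hs.2]⟩)
        (fun r hr => h3 r ⟨by linarith [hr.1, hs.2], by linarith [hr.2, hs.2]⟩)
      linarith)
  simp at this
  linarith

lemma closed_ext {G : ℝ × ℝ × ℝ → ℝ} {S : Set ℝ} (hS : IsClosed S) {x1 x2 y1 y2 t1 t2 x y t : ℝ}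
    (hx12 : x1 < x2) (hy12 : y1 < y2) (ht12 : t1 < t2)
    (hx : x ∈ Icc x1 x2) (hy : y ∈ Icc y1 y2) (ht : t ∈ Icc t1 t2)
    (hG : ContinuousAt G (x, y, t))
    (h : ∀ x' ∈ Ioo x1 x2, ∀ y' ∈ Ioo y1 y2, ∀ t' ∈ Ioo t1 t2, G (x', y', t') ∈ S) :
    G (x, y, t) ∈ S := by
  have hq : (x, y, t) ∈ closure (Ioo x1 x2 ×ˢ Ioo y1 y2 ×ˢ Ioo t1 t2) := by
    rw [closure_prod_eq, closure_prod_eq, closure_Ioo hx12.ne, closure_Ioo hy12.ne,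
      closure_Ioo ht12.ne]
    exact ⟨hx, hy, ht⟩
  haveI := mem_closure_iff_nhdsWithin_neBot.1 hq
  refine hS.mem_of_tendsto (hG.tendsto.mono_left
    (nhdsWithin_le_nhds (s := Ioo x1 x2 ×ˢ Ioo y1 y2 ×ˢ Ioo t1 t2)))
    (Filter.mem_of_superset self_mem_nhdsWithin ?_)
  rintro ⟨x', y', t'⟩ ⟨h1, h2, h3⟩
  exact h x' h1 y' h2 t' h3

lemma sqrt_tri (a b c d : ℝ) :
    Real.sqrt ((a + c) ^ 2 + (b + d) ^ 2) ≤ Real.sqrt (a ^ 2 + b ^ 2) + Real.sqrt (c ^ 2 + d ^ 2) := by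
  have := norm_add_le (⟨a, b⟩ : ℂ) ⟨c, d⟩
  simpa [Complex.norm_eq_sqrt_sq_add_sq] using this

lemma grad_convex {p : ℝ} (hp : 2 < p) {a b c d e f : ℝ} (h1 : 2 * e = a + c) (h2 : 2 * f = b + d) :
    2 * Real.sqrt (e ^ 2 + f ^ 2) ^ p ≤
      Real.sqrt (a ^ 2 + b ^ 2) ^ p + Real.sqrt (c ^ 2 + d ^ 2) ^ p := by
  have h3 := sqrt_tri a b c d
  rw [← h1, ← h2] at h3
  have h4 : Real.sqrt ((2 * e) ^ 2 + (2 * f) ^ 2) = 2 * Real.sqrt (e ^ 2 + f ^ 2) := by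
    rw [show (2 * e) ^ 2 + (2 * f) ^ 2 = 2 ^ 2 * (e ^ 2 + f ^ 2) by ring,
      Real.sqrt_mul (by norm_num), Real.sqrt_sq (by norm_num)]
  rw [h4] at h3
  set A := Real.sqrt (a ^ 2 + b ^ 2)
  set B := Real.sqrt (c ^ 2 + d ^ 2)
  set E := Real.sqrt (e ^ 2 + f ^ 2)
  have hA : 0 ≤ A := Real.sqrt_nonneg _
  have hB : 0 ≤ B := Real.sqrt_nonneg _
  have hE : 0 ≤ E := Real.sqrt_nonneg _
  have h5 : E ^ p ≤ ((1 / 2) * A + (1 / 2) * B) ^ p :=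
    Real.rpow_le_rpow hE (by linarith) (by linarith)
  have h6 := (convexOn_rpow (p := p) (by linarith : 1 ≤ p)).2 (mem_Ici.2 hA) (mem_Ici.2 hB)
    (by norm_num : (0:ℝ) ≤ 1 / 2) (by norm_num : (0:ℝ) ≤ 1 / 2) (by norm_num)
  simp only [smul_eq_mul] at h6
  linarith

section reg
variable {p L T : ℝ} {u : ℝ → ℝ → ℝ → ℝ} {x y t : ℝ}

lemma C21At.hx (h : C21At u x y t) : HasDerivAt (fun s => u s y t) (pdx u x y t) x := h.1.hasDerivAt
lemma C21At.hy (h : C21At u x y t) : HasDerivAt (fun s => u x s t) (pdy u x y t) y :=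
  h.2.1.hasDerivAt
lemma C21At.ht (h : C21At u x y t) : HasDerivAt (fun s => u x y s) (pdt u x y t) t :=
  h.2.2.1.hasDerivAt
lemma C21At.hxx (h : C21At u x y t) : HasDerivAt (fun s => pdx u s y t) (pdxx u x y t) x :=
  h.2.2.2.1.hasDerivAt
lemma C21At.hyy (h : C21At u x y t) : HasDerivAt (fun s => pdy u x s t) (pdyy u x y t) y :=
  h.2.2.2.2.1.hasDerivAt
lemma C21At.c (h : C21At u x y t) :
    ContinuousAt (fun q : ℝ × ℝ × ℝ => u q.1 q.2.1 q.2.2) (x, y, t) := h.2.2.2.2.2.2.1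
lemma C21At.cx (h : C21At u x y t) :
    ContinuousAt (fun q : ℝ × ℝ × ℝ => pdx u q.1 q.2.1 q.2.2) (x, y, t) := h.2.2.2.2.2.2.2.1
lemma C21At.cy (h : C21At u x y t) :
    ContinuousAt (fun q : ℝ × ℝ × ℝ => pdy u q.1 q.2.1 q.2.2) (x, y, t) := h.2.2.2.2.2.2.2.2.1
lemma C21At.ct (h : C21At u x y t) :
    ContinuousAt (fun q : ℝ × ℝ × ℝ => pdt u q.1 q.2.1 q.2.2) (x, y, t) := h.2.2.2.2.2.2.2.2.2.1
lemma C21At.cxx (h : C21At u x y t) :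
    ContinuousAt (fun q : ℝ × ℝ × ℝ => pdxx u q.1 q.2.1 q.2.2) (x, y, t) :=
  h.2.2.2.2.2.2.2.2.2.2.1
lemma C21At.cyy (h : C21At u x y t) :
    ContinuousAt (fun q : ℝ × ℝ × ℝ => pdyy u q.1 q.2.1 q.2.2) (x, y, t) :=
  h.2.2.2.2.2.2.2.2.2.2.2.1

def InK (L T x y t : ℝ) : Prop :=
  |x| ≤ L / 2 ∧ y ∈ Icc 0 (L / 2) ∧ t ∈ Icc (T / 2) T ∧ (L / 8 ≤ |x| ∨ L / 8 ≤ y ∨ t ≤ 3 * T / 4)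

lemma K_bound (hL : 0 < L) (hT : 0 < T) (hext : ExtC21 L T u) :
    ∃ C0 : ℝ, 0 ≤ C0 ∧ ∀ x y t, InK L T x y t →
      C21At u x y t ∧ |pdt u x y t| ≤ C0 ∧ |pdxx u x y t| ≤ C0 ∧ |pdy u x y t| ≤ C0 := by
  set K : Set (ℝ × ℝ × ℝ) := {q | InK L T q.1 q.2.1 q.2.2} with hK
  have hreg : ∀ q ∈ K, C21At u q.1 q.2.1 q.2.2 := by
    rintro ⟨x, y, t⟩ ⟨h1, h2, h3, h4⟩
    refine hext h1 h2 h3 ?_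
    rintro ⟨e1, e2, e3⟩
    simp only at e1 e2 e3
    subst e1 e2 e3
    rcases h4 with h4 | h4 | h4
    · simp at h4; linarith
    · simp at h4; linarith
    · simp at h4; linarith
  have hKc : IsCompact K := by
    refine IsCompact.of_isClosed_subset
      ((isCompact_Icc (a := -(L/2)) (b := L/2)).prod
        ((isCompact_Icc (a := 0) (b := L/2)).prod (isCompact_Icc (a := T/2) (b := T)))) ?_ ?_
    · simp only [hK, InK, mem_Icc]
      refine IsClosed.and (isClosed_le (by fun_prop) (by fun_prop)) (IsClosed.and ?_
        (IsClosed.and ?_ (IsClosed.union (s₁ := {q : ℝ × ℝ × ℝ | L / 8 ≤ |q.1|}) ?_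
        (IsClosed.union (s₁ := {q : ℝ × ℝ × ℝ | L / 8 ≤ q.2.1}) (s₂ := {q : ℝ × ℝ × ℝ | q.2.2 ≤ 3 * T / 4}) ?_ ?_))))
      · exact IsClosed.and (isClosed_le (by fun_prop) (by fun_prop))
          (isClosed_le (by fun_prop) (by fun_prop))
      · exact IsClosed.and (isClosed_le (by fun_prop) (by fun_prop))
          (isClosed_le (by fun_prop) (by fun_prop))
      all_goals exact isClosed_le (by fun_prop) (by fun_prop)
    · rintro ⟨x, y, t⟩ ⟨h1, h2, h3, h4⟩
      exact ⟨abs_le.1 h1, h2, h3⟩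
  obtain ⟨c1, h1⟩ := hKc.exists_bound_of_continuousOn
    (f := fun q : ℝ × ℝ × ℝ => pdt u q.1 q.2.1 q.2.2)
    (fun q hq => (hreg q hq).ct.continuousWithinAt)
  obtain ⟨c2, h2⟩ := hKc.exists_bound_of_continuousOn
    (f := fun q : ℝ × ℝ × ℝ => pdxx u q.1 q.2.1 q.2.2)
    (fun q hq => (hreg q hq).cxx.continuousWithinAt)
  obtain ⟨c3, h3⟩ := hKc.exists_bound_of_continuousOn
    (f := fun q : ℝ × ℝ × ℝ => pdy u q.1 q.2.1 q.2.2)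
    (fun q hq => (hreg q hq).cy.continuousWithinAt)
  refine ⟨max 0 (max c1 (max c2 c3)), le_max_left _ _, fun x y t hq => ?_⟩
  have e1 := h1 (x, y, t) hq
  have e2 := h2 (x, y, t) hq
  have e3 := h3 (x, y, t) hq
  simp only [Real.norm_eq_abs] at e1 e2 e3
  refine ⟨hreg (x, y, t) hq, e1.trans ?_, e2.trans ?_, e3.trans ?_⟩ <;> simp

end reg

section reg2
variable {p L T C0 : ℝ} {u : ℝ → ℝ → ℝ → ℝ}

lemma t_diff (hL : 0 < L) (hT : 0 < T) (hsol : ClassicalSolution p L T u) (hC0 : 0 ≤ C0)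
    (hK : ∀ x y t, InK L T x y t →
      C21At u x y t ∧ |pdt u x y t| ≤ C0 ∧ |pdxx u x y t| ≤ C0 ∧ |pdy u x y t| ≤ C0)
    {h1 h2 t1 : ℝ} (h1n : 0 ≤ h1) (h2n : 0 ≤ h2) (h1T : h1 ≤ T / 4) (h2T : h2 ≤ T / 4)
    (e1 : t1 + h1 < T) (e2 : t1 + h2 < T) :
    ∀ x ∈ Icc (-(L/4)) (L/4), ∀ y ∈ Icc 0 (L/4), ∀ t ∈ Icc (T/2) t1,
      u x y (t + h1) - u x y (t + h2) ≤ C0 * |h1 - h2| := by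
  have reg : ∀ x ∈ Icc (-(L/4)) (L/4), ∀ y ∈ Icc 0 (L/4), ∀ t ∈ Icc (T/2) t1, ∀ h, 0 ≤ h →
      t1 + h < T → C21At u x y (t + h) := by
    intro x hx y hy t ht h hh hhT
    exact hsol.smooth (abs_le.2 ⟨by linarith [hx.1], by linarith [hx.2]⟩)
      ⟨hy.1, by linarith [hy.2]⟩ ⟨by linarith [ht.1], by linarith [ht.2]⟩
  refine maxprin (f := fun x y t => u x y (t + h1) - u x y (t + h2)) ?_ ?_ ?_
  · rintro ⟨x, y, t⟩ ⟨hx, hy, ht⟩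
    have cc : ∀ h, 0 ≤ h → t1 + h < T →
        ContinuousAt (fun q : ℝ × ℝ × ℝ => u q.1 q.2.1 (q.2.2 + h)) (x, y, t) := by
      intro h hh hhT
      have := (reg x hx y hy t ht h hh hhT).c
      exact ContinuousAt.comp (g := fun q : ℝ × ℝ × ℝ => u q.1 q.2.1 q.2.2)
        (f := fun q : ℝ × ℝ × ℝ => (q.1, q.2.1, q.2.2 + h)) (x := (x, y, t)) this (by fun_prop)
    exact ((cc h1 h1n e1).sub (cc h2 h2n e2)).continuousWithinAt
  · intro x hx y hy t ht mx my
    have hx' := Ioo_subset_Icc_self hx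
    have hy' := Ioo_subset_Icc_self hy
    have ht' := Ioc_subset_Icc_self ht
    have r1 := reg x hx' y hy' t ht' h1 h1n e1
    have r2 := reg x hx' y hy' t ht' h2 h2n e2
    have a1 := localmax_second (g := fun s => u s y (t + h1) - u s y (t + h2))
      (g' := fun s => pdx u s y (t + h1) - pdx u s y (t + h2))
      (d := pdxx u x y (t + h1) - pdxx u x y (t + h2))
      (by
        filter_upwards [Ioo_mem_nhds hx.1 hx.2] with s hs
        exact (reg s (Ioo_subset_Icc_self hs) y hy' t ht' h1 h1n e1).hx.fun_sub
          (reg s (Ioo_subset_Icc_self hs) y hy' t ht' h2 h2n e2).hx)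
      (r1.hxx.fun_sub r2.hxx) mx
    have a2 := localmax_second (g := fun s => u x s (t + h1) - u x s (t + h2))
      (g' := fun s => pdy u x s (t + h1) - pdy u x s (t + h2))
      (d := pdyy u x y (t + h1) - pdyy u x y (t + h2))
      (by
        filter_upwards [Ioo_mem_nhds hy.1 hy.2] with s hs
        exact (reg x hx' s (Ioo_subset_Icc_self hs) t ht' h1 h1n e1).hy.fun_sub
          (reg x hx' s (Ioo_subset_Icc_self hs) t ht' h2 h2n e2).hy)
      (r1.hyy.fun_sub r2.hyy) my
    refine ⟨pdt u x y (t + h1) - pdt u x y (t + h2), ?_, ?_⟩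
    · have xx : |x| < L := abs_lt.2 ⟨by linarith [hx.1], by linarith [hx.2]⟩
      have yy : y ∈ Ioo (0:ℝ) L := ⟨hy.1, by linarith [hy.2]⟩
      have q1 := hsol.pde xx yy (t := t + h1) ⟨by linarith [ht.1], by linarith [ht.2]⟩
      have q2 := hsol.pde xx yy (t := t + h2) ⟨by linarith [ht.1], by linarith [ht.2]⟩
      have gx : pdx u x y (t + h1) = pdx u x y (t + h2) := by linarith [a1.1]
      have gy : pdy u x y (t + h1) = pdy u x y (t + h2) := by linarith [a2.1]
      have : gradNorm u x y (t + h1) = gradNorm u x y (t + h2) := by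
        unfold gradNorm; rw [gx, gy]
      rw [this] at q1
      linarith [a1.2, a2.2]
    · exact (r1.ht.comp_add_const t h1).fun_sub (r2.ht.comp_add_const t h2)
  · intro x hx y hy t ht hb
    by_cases hy0 : y = 0
    · subst hy0
      have xx : |x| < L := abs_lt.2 ⟨by linarith [hx.1], by linarith [hx.2]⟩
      simp only [hsol.bc xx (t := t + h1) ⟨by linarith [ht.1], by linarith [ht.2]⟩,
        hsol.bc xx (t := t + h2) ⟨by linarith [ht.1], by linarith [ht.2]⟩, sub_self]
      positivity
    · have hin : ∀ s ∈ uIcc (t + h2) (t + h1), InK L T x y s := by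
        intro s hs
        have hs1 : t ≤ s := le_trans (by simp [h1n, h2n]) hs.1
        have hs2 : s < T := lt_of_le_of_lt hs.2 (max_lt (by linarith [ht.2]) (by linarith [ht.2]))
        refine ⟨abs_le.2 ⟨by linarith [hx.1], by linarith [hx.2]⟩, ⟨hy.1, by linarith [hy.2]⟩,
          ⟨by linarith [ht.1], hs2.le⟩, ?_⟩
        rcases hb with hb | hb | hb | hb | hb
        · left; rw [hb, abs_neg, abs_of_pos (by linarith)]; linarith
        · left; rw [hb, abs_of_pos (by linarith)]; linarith
        · exact absurd hb hy0
        · right; left; linarith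
        · right; right
          refine hs.2.trans (max_le (by linarith) (by linarith))
      have := Convex.norm_image_sub_le_of_norm_hasDerivWithin_le (f := fun s => u x y s)
        (f' := fun s => pdt u x y s) (C := C0) (s := uIcc (t + h2) (t + h1)) (x := t + h2)
        (y := t + h1)
        (fun s hs => (hK x y s (hin s hs)).1.ht.hasDerivWithinAt)
        (fun s hs => (hK x y s (hin s hs)).2.1) (convex_uIcc _ _) left_mem_uIcc right_mem_uIcc
      simp only [Real.norm_eq_abs, add_sub_add_left_eq_sub] at this
      exact (le_abs_self _).trans this

lemma pdt_bound (hL : 0 < L) (hT : 0 < T) (hsol : ClassicalSolution p L T u) (hC0 : 0 ≤ C0)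
    (hK : ∀ x y t, InK L T x y t →
      C21At u x y t ∧ |pdt u x y t| ≤ C0 ∧ |pdxx u x y t| ≤ C0 ∧ |pdy u x y t| ≤ C0)
    {x y t : ℝ} (hx : x ∈ Icc (-(L/4)) (L/4)) (hy : y ∈ Icc 0 (L/4)) (ht : t ∈ Ioo (T/2) T) :
    |pdt u x y t| ≤ C0 := by
  refine norm_deriv_le_of_lip' (𝕜 := ℝ) (f := fun s => u x y s) (x₀ := t) hC0 ?_
  set r := min (T / 4) (min (t - T / 2) ((T - t) / 2)) with hr
  have hr0 : 0 < r := by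
    refine lt_min (by linarith) (lt_min (by linarith [ht.1]) (by linarith [ht.2]))
  have r1 : r ≤ T / 4 := min_le_left _ _
  have r2 : r ≤ t - T / 2 := (min_le_right _ _).trans (min_le_left _ _)
  have r3 : r ≤ (T - t) / 2 := (min_le_right _ _).trans (min_le_right _ _)
  filter_upwards [Ioo_mem_nhds (show t - r < t by linarith) (show t < t + r by linarith)] with s hs
  simp only [Real.norm_eq_abs]
  have key : ∀ s1 s2, s1 ≤ s2 → T / 2 ≤ s1 → s2 < T → s2 - s1 ≤ T / 4 →
      |u x y s2 - u x y s1| ≤ C0 * (s2 - s1) := by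
    intro s1 s2 h12 hs1 hs2 h4
    have A := t_diff hL hT hsol hC0 hK (h1 := s2 - s1) (h2 := 0) (t1 := s1) (by linarith) le_rfl
      h4 (by linarith) (by linarith) (by linarith) x hx y hy s1 ⟨hs1, le_rfl⟩
    have B := t_diff hL hT hsol hC0 hK (h2 := s2 - s1) (h1 := 0) (t1 := s1) le_rfl (by linarith)
      (by linarith) h4 (by linarith) (by linarith) x hx y hy s1 ⟨hs1, le_rfl⟩
    rw [sub_zero, abs_of_nonneg (by linarith)] at A
    rw [zero_sub, abs_neg, abs_of_nonneg (by linarith)] at B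
    simp only [add_zero, add_sub_cancel] at A B
    exact abs_le.2 ⟨by linarith, by linarith⟩
  rcases le_total s t with h | h
  · have := key s t h (by linarith [hs.1]) ht.2 (by linarith [hs.1])
    rw [abs_sub_comm, abs_sub_comm s t, abs_of_nonneg (sub_nonneg.2 h)]
    exact this
  · have := key t s h ht.1.le (by linarith [hs.2]) (by linarith [hs.2])
    rw [abs_of_nonneg (sub_nonneg.2 h)]
    exact this

lemma x_diff (hp : 2 < p) (hL : 0 < L) (hT : 0 < T) (hsol : ClassicalSolution p L T u)
    (hC0 : 0 ≤ C0)
    (hK : ∀ x y t, InK L T x y t →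
      C21At u x y t ∧ |pdt u x y t| ≤ C0 ∧ |pdxx u x y t| ≤ C0 ∧ |pdy u x y t| ≤ C0)
    {h t1 : ℝ} (h1n : 0 < h) (h1L : h ≤ L / 8) (e1 : t1 < T) :
    ∀ x ∈ Icc (-(L/4)) (L/4), ∀ y ∈ Icc 0 (L/4), ∀ t ∈ Icc (T/2) t1,
      2 * u x y t - u (x + h) y t - u (x - h) y t ≤ C0 * h ^ 2 := by
  have reg : ∀ x ∈ Icc (-(L/4)) (L/4), ∀ y ∈ Icc 0 (L/4), ∀ t ∈ Icc (T/2) t1, ∀ h, |h| ≤ L / 8 →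
      C21At u (x + h) y t := by
    intro x hx y hy t ht h hh
    have := abs_le.1 hh
    exact hsol.smooth (abs_le.2 ⟨by linarith [hx.1], by linarith [hx.2]⟩)
      ⟨hy.1, by linarith [hy.2]⟩ ⟨by linarith [ht.1], by linarith [ht.2]⟩
  have b0 : |(0:ℝ)| ≤ L / 8 := by rw [abs_zero]; linarith
  have b1 : |h| ≤ L / 8 := by rw [abs_of_pos h1n]; exact h1L
  have b2 : |-h| ≤ L / 8 := by rw [abs_neg]; exact b1
  refine maxprin (f := fun x y t => 2 * u x y t - u (x + h) y t - u (x - h) y t) ?_ ?_ ?_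
  · rintro ⟨x, y, t⟩ ⟨hx, hy, ht⟩
    have cc : ∀ h, |h| ≤ L / 8 →
        ContinuousAt (fun q : ℝ × ℝ × ℝ => u (q.1 + h) q.2.1 q.2.2) (x, y, t) := by
      intro h hh
      have := (reg x hx y hy t ht h hh).c
      exact ContinuousAt.comp (g := fun q : ℝ × ℝ × ℝ => u q.1 q.2.1 q.2.2)
        (f := fun q : ℝ × ℝ × ℝ => (q.1 + h, q.2.1, q.2.2)) (x := (x, y, t)) this (by fun_prop)
    have c0 := cc 0 b0
    simp only [add_zero] at c0
    exact (((c0.const_mul 2).sub (cc h b1)).sub (cc (-h) b2)).continuousWithinAt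
  · intro x hx y hy t ht mx my
    have hx' := Ioo_subset_Icc_self hx
    have hy' := Ioo_subset_Icc_self hy
    have ht' := Ioc_subset_Icc_self ht
    have rz : ∀ x ∈ Icc (-(L/4)) (L/4), ∀ y ∈ Icc 0 (L/4), C21At u x y t := by
      intro x hx y hy
      have := reg x hx y hy t ht' 0 b0
      rwa [add_zero] at this
    have rp : ∀ x ∈ Icc (-(L/4)) (L/4), ∀ y ∈ Icc 0 (L/4), C21At u (x + h) y t :=
      fun x hx y hy => reg x hx y hy t ht' h b1
    have rm : ∀ x ∈ Icc (-(L/4)) (L/4), ∀ y ∈ Icc 0 (L/4), C21At u (x - h) y t :=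
      fun x hx y hy => reg x hx y hy t ht' (-h) b2
    have a1 := localmax_second (g := fun s => 2 * u s y t - u (s + h) y t - u (s - h) y t)
      (g' := fun s => 2 * pdx u s y t - pdx u (s + h) y t - pdx u (s - h) y t)
      (d := 2 * pdxx u x y t - pdxx u (x + h) y t - pdxx u (x - h) y t)
      (by
        filter_upwards [Ioo_mem_nhds hx.1 hx.2] with s hs
        have hs' := Ioo_subset_Icc_self hs
        exact (((rz s hs' y hy').hx.const_mul 2).fun_sub
          ((rp s hs' y hy').hx.comp_add_const s h)).fun_sub
            ((rm s hs' y hy').hx.comp_sub_const s h))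
      ((((rz x hx' y hy').hxx.const_mul 2).fun_sub
          ((rp x hx' y hy').hxx.comp_add_const x h)).fun_sub
            ((rm x hx' y hy').hxx.comp_sub_const x h)) mx
    have a2 := localmax_second (g := fun s => 2 * u x s t - u (x + h) s t - u (x - h) s t)
      (g' := fun s => 2 * pdy u x s t - pdy u (x + h) s t - pdy u (x - h) s t)
      (d := 2 * pdyy u x y t - pdyy u (x + h) y t - pdyy u (x - h) y t)
      (by
        filter_upwards [Ioo_mem_nhds hy.1 hy.2] with s hs
        have hs' := Ioo_subset_Icc_self hs
        exact (((rz x hx' s hs').hy.const_mul 2).fun_sub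
          (rp x hx' s hs').hy).fun_sub (rm x hx' s hs').hy)
      ((((rz x hx' y hy').hyy.const_mul 2).fun_sub
          (rp x hx' y hy').hyy).fun_sub (rm x hx' y hy').hyy) my
    refine ⟨2 * pdt u x y t - pdt u (x + h) y t - pdt u (x - h) y t, ?_, ?_⟩
    · have yy : y ∈ Ioo (0:ℝ) L := ⟨hy.1, by linarith [hy.2]⟩
      have tt : t ∈ Ioo 0 T := ⟨by linarith [ht.1], by linarith [ht.2]⟩
      have q1 := hsol.pde (x := x) (abs_lt.2 ⟨by linarith [hx.1], by linarith [hx.2]⟩) yy tt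
      have q2 := hsol.pde (x := x + h) (abs_lt.2 ⟨by linarith [hx.1], by linarith [hx.2]⟩) yy tt
      have q3 := hsol.pde (x := x - h) (abs_lt.2 ⟨by linarith [hx.1], by linarith [hx.2]⟩) yy tt
      have := grad_convex hp (e := pdx u x y t) (f := pdy u x y t) (a := pdx u (x + h) y t)
        (c := pdx u (x - h) y t) (b := pdy u (x + h) y t) (d := pdy u (x - h) y t)
        (by linarith [a1.1]) (by linarith [a2.1])
      unfold gradNorm at q1 q2 q3
      linarith [a1.2, a2.2]
    · exact (((rz x hx' y hy').ht.const_mul 2).fun_sub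
          (rp x hx' y hy').ht).fun_sub (rm x hx' y hy').ht
  · intro x hx y hy t ht hb
    by_cases hy0 : y = 0
    · subst hy0
      have tt : t ∈ Ioo 0 T := ⟨by linarith [ht.1], by linarith [ht.2]⟩
      have q1 := hsol.bc (x := x) (abs_lt.2 ⟨by linarith [hx.1], by linarith [hx.2]⟩) tt
      have q2 := hsol.bc (x := x + h) (abs_lt.2 ⟨by linarith [hx.1], by linarith [hx.2]⟩) tt
      have q3 := hsol.bc (x := x - h) (abs_lt.2 ⟨by linarith [hx.1], by linarith [hx.2]⟩) tt
      simp only [q1, q2, q3, mul_zero, sub_self]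
      positivity
    · have hin : ∀ s ∈ Icc (x - h) (x + h), InK L T s y t := by
        intro s hs
        refine ⟨abs_le.2 ⟨by linarith [hx.1, hs.1], by linarith [hx.2, hs.2]⟩,
          ⟨hy.1, by linarith [hy.2]⟩, ⟨ht.1, by linarith [ht.2]⟩, ?_⟩
        rcases hb with hb | hb | hb | hb | hb
        · left; rw [le_abs]; right; linarith [hs.2]
        · left; rw [le_abs]; left; linarith [hs.1]
        · exact absurd hb hy0
        · right; left; linarith
        · right; right; linarith
      exact second_diff (g := fun s => u s y t) (g' := fun s => pdx u s y t)
        (g'' := fun s => pdxx u s y t) h1n.le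
        (fun s hs => (hK s y t (hin s hs)).1.hx) (fun s hs => (hK s y t (hin s hs)).1.hxx)
        (fun s hs => (abs_le.1 (hK s y t (hin s hs)).2.2.1).1)

lemma pdxx_bound (hp : 2 < p) (hL : 0 < L) (hT : 0 < T) (hsol : ClassicalSolution p L T u)
    (hC0 : 0 ≤ C0)
    (hK : ∀ x y t, InK L T x y t →
      C21At u x y t ∧ |pdt u x y t| ≤ C0 ∧ |pdxx u x y t| ≤ C0 ∧ |pdy u x y t| ≤ C0)
    {x y t : ℝ} (hx : x ∈ Icc (-(L/4)) (L/4)) (hy : y ∈ Icc 0 (L/4)) (ht : t ∈ Ioo (T/2) T) :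
    -C0 ≤ pdxx u x y t := by
  by_contra! hlt
  have reg : ∀ s, |s - x| ≤ L / 8 → C21At u s y t := by
    intro s hs
    have := abs_le.1 hs
    exact hsol.smooth (abs_le.2 ⟨by linarith [hx.1], by linarith [hx.2]⟩)
      ⟨hy.1, by linarith [hy.2]⟩ ⟨by linarith [ht.1], by linarith [ht.2]⟩
  obtain ⟨c, hc1, hc2⟩ := exists_between hlt
  have hcont : ContinuousAt (fun s => pdxx u s y t) x :=
    ContinuousAt.comp (g := fun q : ℝ × ℝ × ℝ => pdxx u q.1 q.2.1 q.2.2)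
      (f := fun s : ℝ => (s, y, t)) (x := x) (reg x (by simp; linarith)).cxx (by fun_prop)
  have hev := hcont.eventually (gt_mem_nhds hc1)
  obtain ⟨r, hr, hball⟩ := Metric.eventually_nhds_iff.1 hev
  set h := min (r / 2) (L / 8) with hh
  have h0 : 0 < h := lt_min (by linarith) (by linarith)
  have hr2 : h ≤ r / 2 := min_le_left _ _
  have hL8 : h ≤ L / 8 := min_le_right _ _
  have A := x_diff hp hL hT hsol hC0 hK h0 hL8 ht.2 x hx y hy t ⟨ht.1.le, le_rfl⟩
  have ab : ∀ s ∈ Icc (x - h) (x + h), |s - x| ≤ h := fun s hs =>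
    abs_le.2 ⟨by linarith [hs.1], by linarith [hs.2]⟩
  have B := second_diff (g := fun s => -u s y t) (g' := fun s => -pdx u s y t)
    (g'' := fun s => -pdxx u s y t) (x := x) (h := h) (C := c) h0.le
    (fun s hs => (reg s ((ab s hs).trans hL8)).hx.fun_neg)
    (fun s hs => (reg s ((ab s hs).trans hL8)).hxx.fun_neg)
    (fun s hs => by
      have := hball (y := s) (by rw [Real.dist_eq]; linarith [ab s hs])
      linarith)
  have : 0 < (-C0 - c) * h ^ 2 := mul_pos (by linarith) (by positivity)
  nlinarith

end reg2

/-- closure estimates -/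
structure GoodSol (p L T C0 : ℝ) (u : ℝ → ℝ → ℝ → ℝ) (x y t : ℝ) : Prop where
  reg : C21At u x y t
  pt : |pdt u x y t| ≤ C0
  xx : -C0 ≤ pdxx u x y t
  pde : pdt u x y t - (pdxx u x y t + pdyy u x y t) = gradNorm u x y t ^ p
  nonneg : 0 ≤ u x y t
  xup : 0 ≤ x → pdx u x y t ≤ 0
  xup' : x ≤ 0 → 0 ≤ pdx u x y t
  xlow : 0 ≤ x → -(C0 * x) ≤ pdx u x y t
  xlow' : x ≤ 0 → pdx u x y t ≤ -(C0 * x)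
  yy : pdyy u x y t ≤ 2 * C0
  ylow : -(C0 + 2 * C0 * (L / 4)) ≤ pdy u x y t
  zero : y = 0 → u x y t = 0

lemma good_sol {p L T : ℝ} {u : ℝ → ℝ → ℝ → ℝ} (hp : 2 < p)
    (hL : 0 < L) (hT : 0 < T)
    (hsol : ClassicalSolution p L T u) (hext : ExtC21 L T u) (hmon : MonCond L T u) :
    ∃ C0 : ℝ, 0 ≤ C0 ∧ ∀ x y t, x ∈ Icc (-(L/4)) (L/4) → y ∈ Icc 0 (L/4) → t ∈ Icc (T/2) T →
      ¬(x = 0 ∧ y = 0 ∧ t = T) → GoodSol p L T C0 u x y t := by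
  obtain ⟨C0, hC0, hK⟩ := K_bound hL hT hext
  refine ⟨C0, hC0, ?_⟩
  have reg : ∀ x y t, x ∈ Icc (-(L/4)) (L/4) → y ∈ Icc 0 (L/4) → t ∈ Icc (T/2) T →
      ¬(x = 0 ∧ y = 0 ∧ t = T) → C21At u x y t := fun x y t hx hy ht hn =>
    hext (abs_le.2 ⟨by linarith [hx.1], by linarith [hx.2]⟩) ⟨hy.1, by linarith [hy.2]⟩ ht hn
  have reg' : ∀ x y t, x ∈ Ioo (-(L/4)) (L/4) → y ∈ Ioo 0 (L/4) → t ∈ Ioo (T/2) T →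
      C21At u x y t := fun x y t hx hy ht =>
    reg x y t (Ioo_subset_Icc_self hx) (Ioo_subset_Icc_self hy) (Ioo_subset_Icc_self ht)
      (fun h => ht.2.ne h.2.2)
  have bL : ∀ {x : ℝ}, x ∈ Ioo (-(L/4)) (L/4) → |x| < L := fun hx =>
    abs_lt.2 ⟨by linarith [hx.1], by linarith [hx.2]⟩
  have bL' : ∀ {y : ℝ}, y ∈ Ioo 0 (L/4) → y ∈ Ioo 0 L := fun hx =>
    ⟨hx.1, by linarith [hx.2]⟩
  have bT : ∀ {t : ℝ}, t ∈ Ioo (T/2) T → t ∈ Ioo 0 T := fun hx =>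
    ⟨by linarith [hx.1], hx.2⟩
  have hxx : -(L/4) < L/4 := by linarith
  have hyy : 0 < L/4 := by linarith
  have hxm : -(L/4) < 0 := by linarith
  have htt : T/2 < T := by linarith
  have f1 : ∀ x y t, x ∈ Icc (-(L/4)) (L/4) → y ∈ Icc 0 (L/4) → t ∈ Icc (T/2) T →
      ¬(x = 0 ∧ y = 0 ∧ t = T) → |pdt u x y t| ≤ C0 := fun x y t hx hy ht hn =>
    closed_ext (S := Iic C0) isClosed_Iic hxx hyy htt hx hy ht
      (G := fun q : ℝ × ℝ × ℝ => |pdt u q.1 q.2.1 q.2.2|) (reg x y t hx hy ht hn).ct.abs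
      (fun x' hx' y' hy' t' ht' => pdt_bound hL hT hsol hC0 hK (Ioo_subset_Icc_self hx')
        (Ioo_subset_Icc_self hy') ht')
  have f2 : ∀ x y t, x ∈ Icc (-(L/4)) (L/4) → y ∈ Icc 0 (L/4) → t ∈ Icc (T/2) T →
      ¬(x = 0 ∧ y = 0 ∧ t = T) → -C0 ≤ pdxx u x y t := fun x y t hx hy ht hn =>
    closed_ext (S := Ici (-C0)) isClosed_Ici hxx hyy htt hx hy ht
      (G := fun q : ℝ × ℝ × ℝ => pdxx u q.1 q.2.1 q.2.2) (reg x y t hx hy ht hn).cxx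
      (fun x' hx' y' hy' t' ht' => pdxx_bound hp hL hT hsol hC0 hK (Ioo_subset_Icc_self hx')
        (Ioo_subset_Icc_self hy') ht')
  have f3 : ∀ x y t, x ∈ Icc (-(L/4)) (L/4) → y ∈ Icc 0 (L/4) → t ∈ Icc (T/2) T →
      ¬(x = 0 ∧ y = 0 ∧ t = T) →
      pdt u x y t - (pdxx u x y t + pdyy u x y t) = gradNorm u x y t ^ p := by
    intro x y t hx hy ht hn
    have r := reg x y t hx hy ht hn
    have := closed_ext (S := {0}) isClosed_singleton hxx hyy htt hx hy ht
      (G := fun q : ℝ × ℝ × ℝ => pdt u q.1 q.2.1 q.2.2 - (pdxx u q.1 q.2.1 q.2.2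
        + pdyy u q.1 q.2.1 q.2.2) - gradNorm u q.1 q.2.1 q.2.2 ^ p)
      (by
        refine (r.ct.sub (r.cxx.add r.cyy)).sub ?_
        refine ContinuousAt.rpow_const ?_ (Or.inr (by linarith))
        exact (((r.cx.pow 2).add (r.cy.pow 2)).sqrt))
      (fun x' hx' y' hy' t' ht' => by
        have := hsol.pde (bL hx') (bL' hy') (bT ht')
        simp only [mem_singleton_iff]
        linarith)
    simp only [mem_singleton_iff] at this
    linarith
  have f4 : ∀ x y t, x ∈ Icc (-(L/4)) (L/4) → y ∈ Icc 0 (L/4) → t ∈ Icc (T/2) T →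
      ¬(x = 0 ∧ y = 0 ∧ t = T) → 0 ≤ u x y t := fun x y t hx hy ht hn =>
    closed_ext (S := Ici 0) isClosed_Ici hxx hyy htt hx hy ht
      (G := fun q : ℝ × ℝ × ℝ => u q.1 q.2.1 q.2.2) (reg x y t hx hy ht hn).c
      (fun x' hx' y' hy' t' ht' => hsol.nonneg (bL hx').le (Ioo_subset_Icc_self (bL' hy'))
        (bT ht'))
  have f5 : ∀ x y t, x ∈ Icc (-(L/4)) (L/4) → y ∈ Icc 0 (L/4) → t ∈ Icc (T/2) T →
      ¬(x = 0 ∧ y = 0 ∧ t = T) → 0 ≤ x → pdx u x y t ≤ 0 := fun x y t hx hy ht hn h0 =>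
    closed_ext (S := Iic 0) isClosed_Iic hyy hyy htt ⟨h0, hx.2⟩ hy ht
      (G := fun q : ℝ × ℝ × ℝ => pdx u q.1 q.2.1 q.2.2) (reg x y t hx hy ht hn).cx
      (fun x' hx' y' hy' t' ht' => by
        have := hmon (bL ⟨by linarith [hx'.1], hx'.2⟩) (bL' hy') (bT ht')
        exact nonpos_of_mul_nonpos_right this hx'.1)
  have f6 : ∀ x y t, x ∈ Icc (-(L/4)) (L/4) → y ∈ Icc 0 (L/4) → t ∈ Icc (T/2) T →
      ¬(x = 0 ∧ y = 0 ∧ t = T) → x ≤ 0 → 0 ≤ pdx u x y t := fun x y t hx hy ht hn h0 =>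
    closed_ext (S := Ici 0) isClosed_Ici hxm hyy htt ⟨hx.1, h0⟩ hy ht
      (G := fun q : ℝ × ℝ × ℝ => pdx u q.1 q.2.1 q.2.2) (reg x y t hx hy ht hn).cx
      (fun x' hx' y' hy' t' ht' => by
        have := hmon (bL ⟨hx'.1, by linarith [hx'.2]⟩) (bL' hy') (bT ht')
        by_contra hneg
        simp only [mem_Ici, not_le] at hneg
        have := mul_pos_of_neg_of_neg hx'.2 hneg
        linarith)
  have f0 : ∀ y t, y ∈ Ioo 0 (L/4) → t ∈ Ioo (T/2) T → pdx u 0 y t = 0 := fun y t hy ht =>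
    le_antisymm (f5 0 y t ⟨hxm.le, hyy.le⟩ (Ioo_subset_Icc_self hy) (Ioo_subset_Icc_self ht)
      (fun h => ht.2.ne h.2.2) le_rfl) (f6 0 y t ⟨hxm.le, hyy.le⟩ (Ioo_subset_Icc_self hy)
      (Ioo_subset_Icc_self ht) (fun h => ht.2.ne h.2.2) le_rfl)
  have f7 : ∀ x y t, x ∈ Icc (-(L/4)) (L/4) → y ∈ Icc 0 (L/4) → t ∈ Icc (T/2) T →
      ¬(x = 0 ∧ y = 0 ∧ t = T) → 0 ≤ x → -(C0 * x) ≤ pdx u x y t := by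
    intro x y t hx hy ht hn h0
    have := closed_ext (S := Ici 0) isClosed_Ici hyy hyy htt ⟨h0, hx.2⟩ hy ht
      (G := fun q : ℝ × ℝ × ℝ => pdx u q.1 q.2.1 q.2.2 + C0 * q.1)
      ((reg x y t hx hy ht hn).cx.add (by fun_prop))
      (fun x' hx' y' hy' t' ht' => by
        have := mvt_ge (f := fun s => pdx u s y' t') (f' := fun s => pdxx u s y' t')
          (a := 0) (b := x') (c := -C0) hx'.1.le
          (fun s hs => (reg' s y' t' ⟨by linarith [hs.1], by linarith [hs.2, hx'.2]⟩ hy' ht').hxx)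
          (fun s hs => f2 s y' t' ⟨by linarith [hs.1], by linarith [hs.2, hx'.2]⟩
            (Ioo_subset_Icc_self hy') (Ioo_subset_Icc_self ht') (fun h => ht'.2.ne h.2.2))
        simp only [f0 y' t' hy' ht'] at this
        simp only [mem_Ici]
        linarith)
    simp only [mem_Ici] at this
    linarith
  have f8 : ∀ x y t, x ∈ Icc (-(L/4)) (L/4) → y ∈ Icc 0 (L/4) → t ∈ Icc (T/2) T →
      ¬(x = 0 ∧ y = 0 ∧ t = T) → x ≤ 0 → pdx u x y t ≤ -(C0 * x) := by
    intro x y t hx hy ht hn h0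
    have := closed_ext (S := Iic 0) isClosed_Iic hxm hyy htt ⟨hx.1, h0⟩ hy ht
      (G := fun q : ℝ × ℝ × ℝ => pdx u q.1 q.2.1 q.2.2 + C0 * q.1)
      ((reg x y t hx hy ht hn).cx.add (by fun_prop))
      (fun x' hx' y' hy' t' ht' => by
        have := mvt_ge (f := fun s => pdx u s y' t') (f' := fun s => pdxx u s y' t')
          (a := x') (b := 0) (c := -C0) hx'.2.le
          (fun s hs => (reg' s y' t' ⟨by linarith [hs.1, hx'.1], by linarith [hs.2]⟩ hy' ht').hxx)
          (fun s hs => f2 s y' t' ⟨by linarith [hs.1, hx'.1], by linarith [hs.2]⟩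
            (Ioo_subset_Icc_self hy') (Ioo_subset_Icc_self ht') (fun h => ht'.2.ne h.2.2))
        simp only [f0 y' t' hy' ht'] at this
        simp only [mem_Iic]
        linarith)
    simp only [mem_Iic] at this
    linarith
  have f9 : ∀ x y t, x ∈ Icc (-(L/4)) (L/4) → y ∈ Icc 0 (L/4) → t ∈ Icc (T/2) T →
      ¬(x = 0 ∧ y = 0 ∧ t = T) → pdyy u x y t ≤ 2 * C0 := by
    intro x y t hx hy ht hn
    have h1 := f1 x y t hx hy ht hn
    have h2 := f2 x y t hx hy ht hn
    have h3 := f3 x y t hx hy ht hn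
    have h4 : 0 ≤ gradNorm u x y t ^ p := Real.rpow_nonneg (Real.sqrt_nonneg _) _
    linarith [(abs_le.1 h1).2]
  intro x y t hx hy ht hn
  refine ⟨reg x y t hx hy ht hn, f1 x y t hx hy ht hn, f2 x y t hx hy ht hn, f3 x y t hx hy ht hn,
    f4 x y t hx hy ht hn, f5 x y t hx hy ht hn, f6 x y t hx hy ht hn, f7 x y t hx hy ht hn,
    f8 x y t hx hy ht hn, f9 x y t hx hy ht hn, ?_, ?_⟩
  · have hn' : ∀ s ∈ Icc y (L/4), ¬(x = 0 ∧ s = 0 ∧ t = T) := by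
      rintro s hs ⟨e1, e2, e3⟩
      exact hn ⟨e1, le_antisymm (by linarith [hs.1]) hy.1, e3⟩
    have := mvt_le (f := fun s => pdy u x s t) (f' := fun s => pdyy u x s t) (c := 2 * C0) hy.2
      (fun s hs => (reg x s t hx ⟨by linarith [hs.1, hy.1], hs.2⟩ ht (hn' s hs)).hyy)
      (fun s hs => f9 x s t hx ⟨by linarith [hs.1, hy.1], hs.2⟩ ht (hn' s hs))
    have hk := (hK x (L/4) t ⟨abs_le.2 ⟨by linarith [hx.1], by linarith [hx.2]⟩,
      ⟨by linarith, by linarith⟩, ht, Or.inr (Or.inl (by linarith))⟩).2.2.2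
    have hk' := (abs_le.1 hk).1
    have : 0 ≤ 2 * C0 * y := mul_nonneg (by linarith) hy.1
    linarith
  · rintro rfl
    have hz : ∀ s ∈ Ioo 0 T, u x 0 s = 0 := fun s hs =>
      hsol.bc (abs_lt.2 ⟨by linarith [hx.1], by linarith [hx.2]⟩) hs
    rcases lt_or_eq_of_le ht.2 with h | h
    · exact hz t ⟨by linarith [ht.1], h⟩
    · subst h
      have hc := (reg x 0 t hx hy ht hn).ht.continuousAt.tendsto.mono_left
        (nhdsWithin_le_nhds (s := Iio t))
      refine tendsto_nhds_unique hc (tendsto_const_nhds.congr' ?_)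
      filter_upwards [Ioo_mem_nhdsLT hT] with s hs
      exact (hz s hs).symm

section fin
variable {p L T C0 : ℝ} {u : ℝ → ℝ → ℝ → ℝ}

def AllGood (p L T C0 : ℝ) (u : ℝ → ℝ → ℝ → ℝ) : Prop :=
  ∀ x y t, x ∈ Icc (-(L/4)) (L/4) → y ∈ Icc 0 (L/4) → t ∈ Icc (T/2) T →
      ¬(x = 0 ∧ y = 0 ∧ t = T) → GoodSol p L T C0 u x y t

lemma AllGood.prof (hG : AllGood p L T C0 u) (hC0 : 0 ≤ C0) (hL : 0 < L) {t : ℝ}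
    (ht : t ∈ Icc (T/2) T) :
    Prof p (1 + C0 + 2 * C0 * (L/4)) (min (L/4) 1) (fun x y => u x y t) (fun x y => pdx u x y t)
      (fun x y => pdy u x y t) (fun x y => pdxx u x y t) (fun x y => pdyy u x y t) := by
  have hCL : 0 ≤ 2 * C0 * (L/4) := by positivity
  have g : ∀ X y, 0 < X → X ≤ min (L/4) 1 → 0 ≤ y → y ≤ min (L/4) 1 →
      GoodSol p L T C0 u X y t := fun X y h1 h2 h3 h4 =>
    hG X y t ⟨by linarith, h2.trans (min_le_left _ _)⟩ ⟨h3, h4.trans (min_le_left _ _)⟩ ht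
      (fun h => h1.ne' h.1)
  refine ⟨fun X y h1 h2 h3 h4 => (g X y h1 h2 h3 h4).reg.hx,
    fun X y h1 h2 h3 h4 => (g X y h1 h2 h3 h4).reg.hy,
    fun X y h1 h2 h3 h4 => (g X y h1 h2 h3 h4).reg.hxx,
    fun X y h1 h2 h3 h4 => (g X y h1 h2 h3 h4).reg.hyy,
    fun X y h1 h2 h3 h4 => ?_, fun X y h1 h2 h3 h4 => ?_,
    fun X y h1 h2 h3 h4 => ?_, fun X y h1 h2 h3 h4 => ?_,
    fun X y h1 h2 h3 h4 => (g X y h1 h2 h3 h4).xup h1.le,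
    fun X y h1 h2 h3 h4 => ?_, fun X h1 h2 => ?_⟩
  · exact ContinuousAt.comp (g := fun q : ℝ × ℝ × ℝ => pdxx u q.1 q.2.1 q.2.2)
      (f := fun q : ℝ × ℝ => (q.1, q.2, t)) (x := (X, y)) (g X y h1 h2 h3 h4).reg.cxx
      (by fun_prop)
  · have e := (g X y h1 h2 h3 h4).pde
    have b := (g X y h1 h2 h3 h4).pt
    unfold gradNorm at e
    rw [← e]
    rw [show pdyy u X y t + pdxx u X y t + (pdt u X y t - (pdxx u X y t + pdyy u X y t))
      = pdt u X y t by ring]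
    linarith
  · linarith [(g X y h1 h2 h3 h4).xx]
  · have := (g X y h1 h2 h3 h4).xlow h1.le
    have h5 : 0 ≤ (1 + 2 * C0 * (L/4)) * X := by positivity
    linarith
  · linarith [(g X y h1 h2 h3 h4).ylow]
  · exact (g X 0 h1 h2 le_rfl (by positivity)).zero rfl

lemma AllGood.max0 (hG : AllGood p L T C0 u) (hL : 0 < L) {x y t : ℝ}
    (hx : x ∈ Icc (-(L/4)) (L/4)) (hy : y ∈ Icc 0 (L/4)) (ht : t ∈ Ico (T/2) T) :
    u x y t ≤ u 0 y t := by
  have g : ∀ s ∈ Icc (-(L/4)) (L/4), GoodSol p L T C0 u s y t := fun s hs =>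
    hG s y t hs hy ⟨ht.1, ht.2.le⟩ (fun h => ht.2.ne h.2.2)
  rcases le_total 0 x with h | h
  · have := mvt_le (f := fun s => u s y t) (f' := fun s => pdx u s y t) (c := 0) h
      (fun s hs => (g s ⟨by linarith [hs.1], by linarith [hs.2, hx.2]⟩).reg.hx)
      (fun s hs => (g s ⟨by linarith [hs.1], by linarith [hs.2, hx.2]⟩).xup hs.1)
    linarith
  · have := mvt_ge (f := fun s => u s y t) (f' := fun s => pdx u s y t) (c := 0) h
      (fun s hs => (g s ⟨by linarith [hs.1, hx.1], by linarith [hs.2]⟩).reg.hx)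
      (fun s hs => (g s ⟨by linarith [hs.1, hx.1], by linarith [hs.2]⟩).xup' hs.2)
    linarith

lemma AllGood.blow (hG : AllGood p L T C0 u) (hC0 : 0 ≤ C0) (hL : 0 < L) (hT : 0 < T)
    (hgbu : IsolatedGBU L T u) (M η : ℝ) (hη : 0 < η) :
    ∃ t ∈ Ioo (T/2) T, T - η < t ∧ M < pdy u 0 0 t := by
  have hCL : 0 ≤ C0 * (L/4) := by positivity
  have hd : 0 < min η (min (L/4) (T/2)) := lt_min hη (lt_min (by linarith) (by linarith))
  have d1 : min η (min (L/4) (T/2)) ≤ η := min_le_left _ _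
  have d2 : min η (min (L/4) (T/2)) ≤ L/4 := (min_le_right _ _).trans (min_le_left _ _)
  have d3 : min η (min (L/4) (T/2)) ≤ T/2 := (min_le_right _ _).trans (min_le_right _ _)
  obtain ⟨x, y, t, -, hy, ht, hx', hy', ht', hM⟩ := hgbu.blowup
    (|M| + C0 + 5 * (C0 * (L/4))) _ hd
  have hx1 := abs_lt.1 hx'
  have hx : x ∈ Icc (-(L/4)) (L/4) := ⟨by linarith, by linarith⟩
  have hyy : y ∈ Icc 0 (L/4) := ⟨hy.1, by linarith [(abs_lt.1 hy').2]⟩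
  have htt : t ∈ Ioo (T/2) T := ⟨by linarith, ht.2⟩
  have g : ∀ x ∈ Icc (-(L/4)) (L/4), ∀ s ∈ Icc 0 (L/4), GoodSol p L T C0 u x s t :=
    fun x hx s hs =>
    hG x s t hx hs ⟨htt.1.le, htt.2.le⟩ (fun h => ht.2.ne h.2.2)
  refine ⟨t, htt, by linarith, ?_⟩
  have g0 := g x hx y hyy
  have px : |pdx u x y t| ≤ C0 * (L/4) := by
    rcases le_total 0 x with h | h
    · have h1 := g0.xup h
      have h2 := g0.xlow h
      have h3 := mul_le_mul_of_nonneg_left hx.2 hC0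
      exact abs_le.2 ⟨by linarith, by linarith⟩
    · have h1 := g0.xup' h
      have h2 := g0.xlow' h
      have h3 := mul_le_mul_of_nonneg_left hx.1 hC0
      exact abs_le.2 ⟨by linarith, by linarith⟩
  have hgn : gradNorm u x y t ≤ |pdx u x y t| + |pdy u x y t| := by
    unfold gradNorm
    have := sqrt_tri (pdx u x y t) 0 0 (pdy u x y t)
    simpa [Real.sqrt_sq_eq_abs] using this
  have hM0 := abs_nonneg M
  have hM1 := le_abs_self M
  have py : |M| + 4 * (C0 * (L/4)) < pdy u x y t := by
    have h1 : |M| + C0 + 4 * (C0 * (L/4)) < |pdy u x y t| := by linarith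
    rcases lt_abs.1 h1 with h2 | h2
    · linarith
    · linarith [g0.ylow]
  have py0 : |M| < pdy u x 0 t := by
    have := mvt_le (f := fun s => pdy u x s t) (f' := fun s => pdyy u x s t) (c := 2 * C0) hyy.1
      (fun s hs => (g x hx s ⟨hs.1, hs.2.trans hyy.2⟩).reg.hyy)
      (fun s hs => (g x hx s ⟨hs.1, hs.2.trans hyy.2⟩).yy)
    have h3 := mul_le_mul_of_nonneg_left hyy.2 hC0
    linarith
  have h00 : (0:ℝ) ∈ Icc (-(L/4)) (L/4) := ⟨by linarith, by linarith⟩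
  have h01 : (0:ℝ) ∈ Icc 0 (L/4) := ⟨by linarith, by linarith⟩
  have := deriv_nonneg_of_right (r := L/4) (by linarith)
    ((g 0 h00 0 h01).reg.hy.fun_sub (g x hx 0 h01).reg.hy)
    (by simp only [(g 0 h00 0 h01).zero rfl, (g x hx 0 h01).zero rfl, sub_self])
    (fun s hs => by
      have := hG.max0 hL hx hs (t := t) ⟨htt.1.le, htt.2⟩
      linarith)
  linarith

lemma AllGood.slice0 (hG : AllGood p L T C0 u) (hp : 2 < p) (hL : 0 < L)
    {ε K t y : ℝ} (hε : 0 < ε) (ht : t ∈ Ico (T/2) T) (hy0 : 0 ≤ y) (hy : y ≤ min (L/4) 1 / 2)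
    (hpos : 0 < pdy u 0 0 t)
    (hK : ∀ x, 0 < x → x ≤ min (L/4) 1 / 2 → 0 < pdy u ((1+ε)*x) 0 t →
      ((pdy u ((1+ε)*x) 0 t)^(1-p)+(p-1)*y)^(-(1/(p-1))) - K ≤ pdy u x y t) :
    ((pdy u 0 0 t)^(1-p)+(p-1)*y)^(-(1/(p-1))) - K ≤ pdy u 0 y t := by
  have hδ : 0 < min (L/4) 1 := lt_min (by linarith) one_pos
  have hm : min (L/4) 1 ≤ L/4 := min_le_left _ _
  have h00 : (0:ℝ) ∈ Icc (-(L/4)) (L/4) := ⟨by linarith, by linarith⟩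
  have r : ∀ s ∈ Icc 0 (L/4), C21At u 0 s t := fun s hs =>
    (hG 0 s t h00 hs ⟨ht.1, ht.2.le⟩ (fun h => ht.2.ne h.2.2)).reg
  have r0 := r 0 ⟨le_rfl, by linarith⟩
  have r1 := r y ⟨hy0, by linarith⟩
  have c1 : ContinuousAt (fun x => pdy u x y t) 0 :=
    ContinuousAt.comp (g := fun q : ℝ × ℝ × ℝ => pdy u q.1 q.2.1 q.2.2)
      (f := fun x : ℝ => (x, y, t)) (x := 0) r1.cy (by fun_prop)
  have c0 : ContinuousAt (fun x => pdy u ((1+ε)*x) 0 t) 0 :=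
    ContinuousAt.comp (g := fun q : ℝ × ℝ × ℝ => pdy u q.1 q.2.1 q.2.2)
      (f := fun x : ℝ => ((1+ε)*x, 0, t)) (x := 0) (by simpa using r0.cy) (by fun_prop)
  have e0 : pdy u ((1+ε)*0) 0 t = pdy u 0 0 t := by rw [mul_zero]
  have c2 : ContinuousAt (fun x => ((pdy u ((1+ε)*x) 0 t)^(1-p)+(p-1)*y)^(-(1/(p-1))) - K) 0 := by
    refine ContinuousAt.sub (ContinuousAt.rpow_const (ContinuousAt.add
      (c0.rpow_const (Or.inl ?_)) continuousAt_const) (Or.inl ?_)) continuousAt_const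
    · rw [e0]; exact hpos.ne'
    · rw [e0]
      have : 0 < (pdy u 0 0 t)^(1-p) := Real.rpow_pos_of_pos hpos _
      have : 0 ≤ (p-1)*y := mul_nonneg (by linarith) hy0
      positivity
  have t2 := c2.tendsto.mono_left (nhdsWithin_le_nhds (s := Ioi 0))
  have t1 := c1.tendsto.mono_left (nhdsWithin_le_nhds (s := Ioi 0))
  rw [e0] at t2
  refine le_of_tendsto_of_tendsto t2 t1 ?_
  have ev : ∀ᶠ x in nhdsWithin (0:ℝ) (Ioi 0), 0 < pdy u ((1+ε)*x) 0 t :=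
    (c0.eventually (lt_mem_nhds (by simpa using hpos))).filter_mono nhdsWithin_le_nhds
  filter_upwards [ev, Ioo_mem_nhdsGT (show 0 < min (L/4) 1 / 2 by linarith)] with x h1 h2
  exact hK x h2.1 h2.2.le h1

lemma lim_infty (hp : 2 < p) {y : ℝ} (hy : 0 < y) :
    Tendsto (fun m : ℝ => (m^(1-p)+(p-1)*y)^(-(1/(p-1)))) atTop
      (nhds (((p-1)*y)^(-(1/(p-1))))) := by
  have h1 : Tendsto (fun m : ℝ => m^(1-p)) atTop (nhds 0) := by
    have := tendsto_rpow_neg_atTop (y := p - 1) (by linarith)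
    simpa [neg_sub] using this
  have h2 := h1.add_const ((p-1)*y)
  rw [zero_add] at h2
  have hpos : 0 < (p-1)*y := mul_pos (by linarith) hy
  exact h2.rpow_const (Or.inl hpos.ne')

lemma AllGood.final0 (hG : AllGood p L T C0 u) (hp : 2 < p) (hC0 : 0 ≤ C0) (hL : 0 < L)
    (hT : 0 < T) (hgbu : IsolatedGBU L T u)
    {ε K y : ℝ} (hε : 0 < ε) (hy0 : 0 < y) (hy : y ≤ min (L/4) 1 / 2)
    (hK : ∀ t ∈ Icc (T/2) T, ∀ x, 0 < x → x ≤ min (L/4) 1 / 2 → 0 < pdy u ((1+ε)*x) 0 t →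
      ((pdy u ((1+ε)*x) 0 t)^(1-p)+(p-1)*y)^(-(1/(p-1))) - K ≤ pdy u x y t) :
    ((p-1)*y)^(-(1/(p-1))) - K ≤ pdy u 0 y T := by
  by_contra! hlt
  obtain ⟨c, hc1, hc2⟩ := exists_between hlt
  have hδ : 0 < min (L/4) 1 := lt_min (by linarith) one_pos
  have hm : min (L/4) 1 ≤ L/4 := min_le_left _ _
  have h00 : (0:ℝ) ∈ Icc (-(L/4)) (L/4) := ⟨by linarith, by linarith⟩
  have r := (hG 0 y T h00 ⟨hy0.le, by linarith⟩ ⟨by linarith, le_rfl⟩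
    (fun h => hy0.ne' h.2.1)).reg
  have c1 : ContinuousAt (fun t => pdy u 0 y t) T :=
    ContinuousAt.comp (g := fun q : ℝ × ℝ × ℝ => pdy u q.1 q.2.1 q.2.2)
      (f := fun t : ℝ => (0, y, t)) (x := T) r.cy (by fun_prop)
  obtain ⟨η, hη, hball⟩ := Metric.eventually_nhds_iff.1 (c1.eventually (gt_mem_nhds hc1))
  have hl := (lim_infty hp hy0).eventually (lt_mem_nhds (show c + K < _ by linarith))
  obtain ⟨M, hM⟩ := eventually_atTop.1 hl
  obtain ⟨t, ht, htη, hMt⟩ := hG.blow hC0 hL hT hgbu (max M 0) η hη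
  have h1 := hM _ ((le_max_left M 0).trans hMt.le)
  have h2 := hG.slice0 hp hL hε (t := t) ⟨ht.1.le, ht.2⟩ hy0.le hy
    ((le_max_right M 0).trans_lt hMt) (hK t ⟨ht.1.le, ht.2.le⟩)
  have h3 := hball (y := t) (by rw [Real.dist_eq, abs_lt]; constructor <;> linarith [ht.2])
  linarith

lemma AllGood.pos (hG : AllGood p L T C0 u) (hp : 2 < p) (hC0 : 0 ≤ C0) (hL : 0 < L)
    (hT : 0 < T) {K : ℝ}
    (h0 : ∀ y, 0 < y → y ≤ min (L/4) 1 / 2 → ((p-1)*y)^(-(1/(p-1))) - K ≤ pdy u 0 y T) :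
    ∃ r > 0, ∀ X, 0 < X → X < r → 0 < pdy u X 0 T := by
  have hδ : 0 < min (L/4) 1 := lt_min (by linarith) one_pos
  have hm : min (L/4) 1 ≤ L/4 := min_le_left _ _
  have h00 : (0:ℝ) ∈ Icc (-(L/4)) (L/4) := ⟨by linarith, by linarith⟩
  have hTT : T ∈ Icc (T/2) T := ⟨by linarith, le_rfl⟩
  have hl : Tendsto (fun y : ℝ => ((p-1)*y)^(-(1/(p-1)))) (nhdsWithin 0 (Ioi 0)) atTop := by
    have h1 : Tendsto (fun y : ℝ => (p-1)*y) (nhdsWithin 0 (Ioi 0)) (nhdsWithin 0 (Ioi 0)) := by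
      refine tendsto_nhdsWithin_iff.2 ⟨?_, ?_⟩
      · have : Continuous (fun y : ℝ => (p-1)*y) := by fun_prop
        have := (this.tendsto 0).mono_left (nhdsWithin_le_nhds (s := Ioi 0))
        rwa [mul_zero] at this
      · filter_upwards [self_mem_nhdsWithin] with y hy
        have hp1 : 0 < p - 1 := by linarith
        exact mul_pos hp1 (mem_Ioi.1 hy)
    refine (tendsto_rpow_neg_nhdsGT_zero ?_).comp h1
    have : 0 < 1/(p-1) := by apply one_div_pos.2; linarith
    linarith
  have hev := hl.eventually (eventually_ge_atTop (K + 1))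
  obtain ⟨y1, hy1, hsub⟩ := mem_nhdsGT_iff_exists_Ioo_subset.1 hev
  simp only [mem_Ioi] at hy1
  set Y := min (y1/2) (min (min (L/4) 1 / 2) (1 / (16 * (C0 + 1)))) with hY
  have hY0 : 0 < Y := lt_min (by linarith) (lt_min (by linarith) (by positivity))
  have hYa : Y ≤ y1/2 := min_le_left _ _
  have hYb : Y ≤ min (L/4) 1 / 2 := (min_le_right _ _).trans (min_le_left _ _)
  have hYc : Y ≤ 1 / (16 * (C0 + 1)) := (min_le_right _ _).trans (min_le_right _ _)
  rw [le_div_iff₀ (by positivity)] at hYc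
  have g0 : ∀ s, 0 < s → s ≤ Y → GoodSol p L T C0 u 0 s T := fun s h1 h2 =>
    hG 0 s T h00 ⟨h1.le, by linarith⟩ hTT (fun h => h1.ne' h.2.1)
  have hv : Y / 2 ≤ u 0 Y T := by
    have := mvt_ge (f := fun s => u 0 s T) (f' := fun s => pdy u 0 s T) (c := 1)
      (show Y/2 ≤ Y by linarith)
      (fun s hs => (g0 s (by linarith [hs.1]) hs.2).reg.hy)
      (fun s hs => by
        have h1 : 0 < s := by linarith [hs.1]
        have h2 := h0 s h1 (hs.2.trans hYb)
        have h3 : K + 1 ≤ ((p-1)*s)^(-(1/(p-1))) := hsub ⟨h1, by linarith [hs.2]⟩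
        linarith)
    have := (g0 (Y/2) (by linarith) (by linarith)).nonneg
    linarith
  have c1 : ContinuousAt (fun x => u x Y T) 0 := (g0 Y hY0 le_rfl).reg.hx.continuousAt
  obtain ⟨r, hr, hball⟩ := Metric.eventually_nhds_iff.1
    (c1.eventually (lt_mem_nhds (show Y/4 < _ by linarith)))
  refine ⟨min r (L/4), lt_min hr (by linarith), fun X hX hXr => ?_⟩
  have hXr1 : X < r := hXr.trans_le (min_le_left _ _)
  have hXr2 : X < L/4 := hXr.trans_le (min_le_right _ _)
  have h1 := hball (y := X) (by rw [Real.dist_eq, sub_zero, abs_of_pos hX]; exact hXr1)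
  have g : ∀ s, 0 ≤ s → s ≤ Y → GoodSol p L T C0 u X s T := fun s h1 h2 =>
    hG X s T ⟨by linarith, hXr2.le⟩ ⟨h1, by linarith⟩ hTT (fun h => hX.ne' h.1)
  by_contra! hneg
  have h2 : ∀ s ∈ Icc 0 Y, pdy u X s T ≤ 2 * C0 * Y := by
    intro s hs
    have := mvt_le (f := fun s => pdy u X s T) (f' := fun s => pdyy u X s T) (c := 2 * C0) hs.1
      (fun s' hs' => (g s' hs'.1 (hs'.2.trans hs.2)).reg.hyy)
      (fun s' hs' => (g s' hs'.1 (hs'.2.trans hs.2)).yy)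
    have h3 := mul_le_mul_of_nonneg_left hs.2 hC0
    linarith
  have h3 := mvt_le (f := fun s => u X s T) (f' := fun s => pdy u X s T) (c := 2 * C0 * Y) hY0.le
    (fun s hs => (g s hs.1 hs.2).reg.hy) h2
  have h4 := (g 0 le_rfl hY0.le).zero rfl
  have h5 : C0 * Y * Y ≤ (1/16) * Y := mul_le_mul_of_nonneg_right (by linarith) hY0.le
  simp only [h4, sub_zero] at h3
  linarith

end fin

/-- Lemma 3.4: for each `ε ∈ (0,1)` the final profile `v = u(·,·,T)` satisfies
`v_y(x,y) ≥ [(v_y((1+ε)x,0))^{1-p} + (p-1)y]^{-β} - C` on `ω̄_ρ \ {(0,0)}`, `x ≥ 0`,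
where `β = 1/(p-1)`. -/
theorem vy_lower_averaged (p L T : ℝ) (hp : 2 < p)
    (hL : 0 < L) (hT : 0 < T) (u : ℝ → ℝ → ℝ → ℝ)
    (hsol : ClassicalSolution p L T u) (hgbu : IsolatedGBU L T u)
    (hext : ExtC21 L T u) (hmon : MonCond L T u) :
    ∀ ε : ℝ, ε ∈ Ioo (0:ℝ) 1 → ∃ C ρ : ℝ, 0 < C ∧ 0 < ρ ∧ ρ < L/2 ∧
      ∀ x y : ℝ, 0 ≤ x → x ≤ ρ → y ∈ Icc (0:ℝ) ρ → ¬(x = 0 ∧ y = 0) →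
        ((pdy u ((1 + ε) * x) 0 T) ^ (1 - p) + (p - 1) * y) ^ (-(1/(p-1))) - C
          ≤ pdy u x y T := by
  intro ε hε
  obtain ⟨C0, hC0, hG'⟩ := good_sol hp hL hT hsol hext hmon
  have hG : AllGood p L T C0 u := hG'
  have hCL : 0 ≤ 2 * C0 * (L/4) := by positivity
  have hδ : 0 < min (L/4) 1 := lt_min (by linarith) one_pos
  have hm : min (L/4) 1 ≤ L/4 := min_le_left _ _
  obtain ⟨K, hK0, hK⟩ := prof_key (C := 1 + C0 + 2 * C0 * (L/4)) hp (by linarith) hδ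
    (min_le_right (L/4) 1) hε.1 hε.2
  have hKt : ∀ t ∈ Icc (T/2) T, ∀ x y, 0 < x → x ≤ min (L/4) 1 / 2 → 0 ≤ y →
      y ≤ min (L/4) 1 / 2 → 0 < pdy u ((1+ε)*x) 0 t →
      ((pdy u ((1+ε)*x) 0 t)^(1-p)+(p-1)*y)^(-(1/(p-1))) - K ≤ pdy u x y t := by
    intro t ht x y h1 h2 h3 h4 h5
    exact hK _ _ _ _ _ (hG.prof hC0 hL ht) x y h1 h2 h3 h4 h5
  have h0 : ∀ y, 0 < y → y ≤ min (L/4) 1 / 2 →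
      ((p-1)*y)^(-(1/(p-1))) - K ≤ pdy u 0 y T := fun y h1 h2 =>
    hG.final0 hp hC0 hL hT hgbu hε.1 h1 h2
      (fun t ht x h3 h4 h5 => hKt t ht x y h3 h4 h1.le h2 h5)
  obtain ⟨r, hr, hpos⟩ := hG.pos hp hC0 hL hT h0
  set c := (pdy u 0 0 T) ^ (1 - p) with hc
  have hTT : T ∈ Icc (T/2) T := ⟨by linarith, le_rfl⟩
  have hp1 : 0 < p - 1 := by linarith
  have hβ : -(1/(p-1)) ≤ 0 := by
    have := one_div_pos.2 hp1
    linarith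
  -- radius for the junk case
  obtain ⟨ρ1, hρ1, hρc⟩ : ∃ ρ1 > 0, c < 0 → (p-1) * ρ1 ≤ |c| / 2 := by
    by_cases h : c < 0
    · have h1 : 0 < |c| := abs_pos.2 h.ne
      exact ⟨|c| / 2 / (p-1), by positivity, fun _ => by rw [mul_div_cancel₀ _ hp1.ne']⟩
    · exact ⟨1, one_pos, fun h' => absurd h' h⟩
  set D := (|c|/2) ^ (-(1/(p-1))) with hD
  have hD0 : 0 ≤ D := Real.rpow_nonneg (by positivity) _
  refine ⟨K + (C0 + 2 * C0 * (L/4)) + D, min ρ1 (min (r/3) (min (L/4) 1 / 2)), by linarith,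
    lt_min hρ1 (lt_min (by linarith) (by linarith)), ?_, ?_⟩
  · have : min ρ1 (min (r/3) (min (L/4) 1 / 2)) ≤ min (L/4) 1 / 2 :=
      (min_le_right _ _).trans (min_le_right _ _)
    linarith
  intro x y hx0 hxρ hy hne
  have b1 : min ρ1 (min (r/3) (min (L/4) 1 / 2)) ≤ ρ1 := min_le_left _ _
  have b2 : min ρ1 (min (r/3) (min (L/4) 1 / 2)) ≤ r/3 :=
    (min_le_right _ _).trans (min_le_left _ _)
  have b3 : min ρ1 (min (r/3) (min (L/4) 1 / 2)) ≤ min (L/4) 1 / 2 :=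
    (min_le_right _ _).trans (min_le_right _ _)
  rcases hx0.lt_or_eq with hx | hx
  · have hX : (1+ε)*x < r := by
      have : (1+ε)*x ≤ 2*x := mul_le_mul_of_nonneg_right (by linarith [hε.2]) hx.le
      linarith
    have := hKt T hTT x y hx (hxρ.trans b3) hy.1 (hy.2.trans b3)
      (hpos _ (mul_pos (by linarith [hε.1]) hx) hX)
    linarith
  · subst hx
    have hy0 : 0 < y := lt_of_le_of_ne hy.1 (fun h => hne ⟨rfl, h.symm⟩)
    rw [mul_zero, ← hc]
    by_cases hcn : c < 0
    · have h1 := hρc hcn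
      have h2 : (p-1) * y ≤ (p-1) * ρ1 := mul_le_mul_of_nonneg_left (hy.2.trans b1) hp1.le
      have hca : |c| = -c := abs_of_neg hcn
      have h3 : |c|/2 ≤ |c + (p-1)*y| := by
        rw [le_abs]; right; linarith
      have h4 : (c + (p-1)*y) ^ (-(1/(p-1))) ≤ D := by
        refine (le_abs_self _).trans ((Real.abs_rpow_le_abs_rpow _ _).trans ?_)
        exact Real.rpow_le_rpow_of_nonpos (by linarith) h3 hβ
      have := (hG 0 y T ⟨by linarith, by linarith⟩ ⟨hy.1, by linarith [hy.2]⟩ hTT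
        (fun h => hy0.ne' h.2.1)).ylow
      linarith
    · have h1 : (c + (p-1)*y) ^ (-(1/(p-1))) ≤ ((p-1)*y) ^ (-(1/(p-1))) :=
        Real.rpow_le_rpow_of_nonpos (mul_pos hp1 hy0) (by linarith) hβ
      have := h0 y hy0 (hy.2.trans b3)
      linarith
end
end

section
/- Let p>2, let u be a nonnegative classical solution of u_t−Δu=|∇u|^p in Q_T with u=0 on Γ_T, having an isolated gradient blowup point at (0,0,T) and satisfying the monotonicity condition x·u_x≤0 in Q_T, and let v:=u(·,·,T). Then there exist constants K>0 and ρ∈(0,L) such that, with β=1/(p−1) and c_p=(1−β)^{−1}β^β, v(x,y) ≥ (c_p/2)·y^{1−β} for all (x,y)∈ω_ρ with y ≥ K·x^{2/(1−β)}, where ω_ρ=(−ρ,ρ)×(0,ρ). -/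
open Real Set Filter MeasureTheory

noncomputable section

lemma aux_second {f : ℝ → ℝ} {x : ℝ} (hc : ContinuousAt f x) (h : IsLocalMax f x) :
    deriv (deriv f) x ≤ 0 := by
  by_contra hn
  push Not at hn
  have h0 := h.deriv_eq_zero
  have hmin := isLocalMin_of_deriv_deriv_pos hn h0 hc
  have heq : f =ᶠ[nhds x] fun _ => f x := by
    filter_upwards [h, hmin] with s h1 h2
    exact le_antisymm h1 h2
  have h2 := heq.deriv.deriv_eq
  rw [h2] at hn
  simp at hn

lemma aux_deriv_le {f : ℝ → ℝ} {x C r : ℝ} (hf : DifferentiableAt ℝ f x) (hr : 0 < r)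
    (h : ∀ k, 0 < k → k < r → f (x + k) - f x ≤ C * k) : deriv f x ≤ C := by
  refine le_of_tendsto hf.hasDerivAt.tendsto_slope_zero_right ?_
  filter_upwards [Ioo_mem_nhdsGT hr] with k hk
  have := h k hk.1 hk.2
  rw [smul_eq_mul, inv_mul_le_iff₀ hk.1]
  linarith

lemma aux_deriv_ge {f : ℝ → ℝ} {x C r : ℝ} (hf : DifferentiableAt ℝ f x) (hr : 0 < r)
    (h : ∀ k, 0 < k → k < r → C * k ≤ f x - f (x - k)) : C ≤ deriv f x := by
  refine ge_of_tendsto hf.hasDerivAt.tendsto_slope_zero_left ?_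
  filter_upwards [Ioo_mem_nhdsLT (show -r < 0 by linarith)] with k hk
  have := h (-k) (by linarith [hk.2]) (by linarith [hk.1])
  rw [sub_neg_eq_add] at this
  have h2 : k⁻¹ • (f (x + k) - f x) = (f x - f (x + k)) / (-k) := by
    have : k ≠ 0 := hk.2.ne
    rw [smul_eq_mul]; field_simp; ring
  rw [h2, le_div_iff₀ (by linarith [hk.2])]
  linarith

lemma aux_maxp (a b t0 t1 c : ℝ) (d : ℝ → ℝ → ℝ → ℝ)
    (hc : ContinuousOn (fun q : ℝ × ℝ × ℝ => d q.1 q.2.1 q.2.2)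
      (Icc (-a) a ×ˢ Icc 0 b ×ˢ Icc t0 t1))
    (hd : ∀ x ∈ Ioo (-a) a, ∀ y ∈ Ioo 0 b, ∀ t ∈ Ioc t0 t1,
      ContinuousAt (fun s => d s y t) x ∧ ContinuousAt (fun s => d x s t) y ∧
      DifferentiableAt ℝ (fun s => d x y s) t ∧
      (pdx d x y t = 0 → pdy d x y t = 0 → pdt d x y t ≤ pdxx d x y t + pdyy d x y t))
    (hb : ∀ x ∈ Icc (-a) a, ∀ y ∈ Icc 0 b, ∀ t ∈ Icc t0 t1,
      (x = -a ∨ x = a ∨ y = 0 ∨ y = b ∨ t = t0) → d x y t ≤ c) :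
    ∀ x ∈ Icc (-a) a, ∀ y ∈ Icc 0 b, ∀ t ∈ Icc t0 t1, d x y t ≤ c := by
  intro x hx y hy t ht
  by_contra hn
  push Not at hn
  have htt : 0 ≤ t1 - t0 := by linarith [ht.1, ht.2]
  obtain ⟨ε, hε, hε2⟩ : ∃ ε : ℝ, 0 < ε ∧ ε * (t1 - t0) < d x y t - c := by
    refine ⟨(d x y t - c) / (2 * (t1 - t0 + 1)), by apply div_pos <;> linarith, ?_⟩
    rw [div_mul_eq_mul_div, div_lt_iff₀ (by linarith)]
    nlinarith
  have hcF : ContinuousOn (fun q : ℝ × ℝ × ℝ => d q.1 q.2.1 q.2.2 - ε * (q.2.2 - t0))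
      (Icc (-a) a ×ˢ Icc 0 b ×ˢ Icc t0 t1) := hc.sub (by fun_prop)
  obtain ⟨⟨X, Y, S⟩, hq, hmax⟩ := (isCompact_Icc.prod (isCompact_Icc.prod isCompact_Icc)).exists_isMaxOn
    ⟨(x, y, t), hx, hy, ht⟩ hcF
  obtain ⟨hX, hY, hS⟩ := hq
  simp only at hX hY hS
  have hm : ∀ x ∈ Icc (-a) a, ∀ y ∈ Icc 0 b, ∀ t ∈ Icc t0 t1,
      d x y t - ε * (t - t0) ≤ d X Y S - ε * (S - t0) := by
    intro x hx y hy t ht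
    exact hmax (show ((x, y, t) : ℝ × ℝ × ℝ) ∈ _ from ⟨hx, hy, ht⟩)
  have h1 := hm x hx y hy t ht
  have hgt : c < d X Y S := by
    have : ε * (t - t0) ≤ ε * (t1 - t0) := by
      apply mul_le_mul_of_nonneg_left _ hε.le; linarith [ht.2]
    have : 0 ≤ ε * (S - t0) := mul_nonneg hε.le (by linarith [hS.1])
    linarith
  have hint : ¬ (X = -a ∨ X = a ∨ Y = 0 ∨ Y = b ∨ S = t0) := fun h =>
    absurd (hb X hX Y hY S hS h) (not_le.2 hgt)
  push Not at hint
  obtain ⟨n1, n2, n3, n4, n5⟩ := hint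
  have hX' : X ∈ Ioo (-a) a := ⟨lt_of_le_of_ne hX.1 (Ne.symm n1), lt_of_le_of_ne hX.2 n2⟩
  have hY' : Y ∈ Ioo 0 b := ⟨lt_of_le_of_ne hY.1 (Ne.symm n3), lt_of_le_of_ne hY.2 n4⟩
  have hS' : S ∈ Ioc t0 t1 := ⟨lt_of_le_of_ne hS.1 (Ne.symm n5), hS.2⟩
  obtain ⟨c1, c2, c3, c4⟩ := hd X hX' Y hY' S hS'
  have m1 : IsLocalMax (fun s => d s Y S) X := by
    filter_upwards [Icc_mem_nhds hX'.1 hX'.2] with s hs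
    have := hm s hs Y hY S hS
    linarith
  have m2 : IsLocalMax (fun s => d X s S) Y := by
    filter_upwards [Icc_mem_nhds hY'.1 hY'.2] with s hs
    have := hm X hX s hs S hS
    linarith
  have e1 : pdxx d X Y S ≤ 0 := aux_second c1 m1
  have e2 : pdyy d X Y S ≤ 0 := aux_second c2 m2
  have e3 := c4 m1.deriv_eq_zero m2.deriv_eq_zero
  have e4 : ε ≤ pdt d X Y S := by
    refine aux_deriv_ge c3 (r := S - t0) (by linarith [hS'.1]) ?_
    intro k hk hk2
    have := hm X hX Y hY (S - k) ⟨by linarith, by linarith [hS.2]⟩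
    have h3 : ε * (S - k - t0) = ε * (S - t0) - ε * k := by ring
    linarith
  linarith

lemma aux_conv {p : ℝ} (hp : 2 < p) (a b c d : ℝ) :
    Real.sqrt (((a + c) / 2) ^ 2 + ((b + d) / 2) ^ 2) ^ p ≤
      (Real.sqrt (a ^ 2 + b ^ 2) ^ p + Real.sqrt (c ^ 2 + d ^ 2) ^ p) / 2 := by
  have h1 : Real.sqrt (((a + c) / 2) ^ 2 + ((b + d) / 2) ^ 2) ≤
      (1/2 : ℝ) * Real.sqrt (a ^ 2 + b ^ 2) + (1/2 : ℝ) * Real.sqrt (c ^ 2 + d ^ 2) := by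
    have h := norm_add_le ((a : ℂ) + b * Complex.I) ((c : ℂ) + d * Complex.I)
    have e : ((a : ℂ) + b * Complex.I) + ((c : ℂ) + d * Complex.I)
      = ((a + c : ℝ) : ℂ) + ((b + d : ℝ) : ℂ) * Complex.I := by push_cast; ring
    rw [e, Complex.norm_add_mul_I, Complex.norm_add_mul_I, Complex.norm_add_mul_I] at h
    have e2 : ((a + c) / 2) ^ 2 + ((b + d) / 2) ^ 2 = ((a + c) ^ 2 + (b + d) ^ 2) / 2 ^ 2 := by ring
    rw [e2, Real.sqrt_div' _ (by positivity), Real.sqrt_sq (by norm_num)]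
    linarith
  have h2 := (convexOn_rpow (p := p) (by linarith)).2
    (show Real.sqrt (a ^ 2 + b ^ 2) ∈ Ici 0 from Real.sqrt_nonneg _)
    (show Real.sqrt (c ^ 2 + d ^ 2) ∈ Ici 0 from Real.sqrt_nonneg _)
    (show (0:ℝ) ≤ 1/2 by norm_num) (show (0:ℝ) ≤ 1/2 by norm_num) (by norm_num)
  simp only [smul_eq_mul] at h2
  have h3 := Real.rpow_le_rpow (Real.sqrt_nonneg _) h1 (show 0 ≤ p by linarith)
  linarith

def sh (u : ℝ → ℝ → ℝ → ℝ) (a b c : ℝ) : ℝ → ℝ → ℝ → ℝ :=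
  fun x y t => u (x + a) (y + b) (t + c)

lemma sh_pdx (u : ℝ → ℝ → ℝ → ℝ) (a b c : ℝ) : pdx (sh u a b c) = sh (pdx u) a b c := by
  funext x y t
  exact deriv_comp_add_const (fun s => u s (y + b) (t + c)) a x
lemma sh_pdy (u : ℝ → ℝ → ℝ → ℝ) (a b c : ℝ) : pdy (sh u a b c) = sh (pdy u) a b c := by
  funext x y t
  exact deriv_comp_add_const (fun s => u (x + a) s (t + c)) b y
lemma sh_pdt (u : ℝ → ℝ → ℝ → ℝ) (a b c : ℝ) : pdt (sh u a b c) = sh (pdt u) a b c := by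
  funext x y t
  exact deriv_comp_add_const (fun s => u (x + a) (y + b) s) c t
lemma pdxx_def (u : ℝ → ℝ → ℝ → ℝ) : pdxx u = pdx (pdx u) := rfl
lemma pdyy_def (u : ℝ → ℝ → ℝ → ℝ) : pdyy u = pdy (pdy u) := rfl

/-- reduced regularity -/
structure Reg (u : ℝ → ℝ → ℝ → ℝ) (x y t : ℝ) : Prop where
  dx : DifferentiableAt ℝ (fun s => u s y t) x
  dy : DifferentiableAt ℝ (fun s => u x s t) y
  dt : DifferentiableAt ℝ (fun s => u x y s) t
  dxx : DifferentiableAt ℝ (fun s => pdx u s y t) x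
  dyy : DifferentiableAt ℝ (fun s => pdy u x s t) y
  ct : ContinuousAt (fun q : ℝ × ℝ × ℝ => u q.1 q.2.1 q.2.2) (x, y, t)

lemma C21At.reg {u : ℝ → ℝ → ℝ → ℝ} {x y t : ℝ} (h : C21At u x y t) : Reg u x y t :=
  ⟨h.1, h.2.1, h.2.2.1, h.2.2.2.1, h.2.2.2.2.1, h.2.2.2.2.2.2.1⟩

lemma aux_shift {f : ℝ → ℝ} {x a : ℝ} (h : DifferentiableAt ℝ f (x + a)) :
    DifferentiableAt ℝ (fun s => f (s + a)) x :=
  (h.hasDerivAt.comp_add_const x a).differentiableAt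

lemma Reg.sh {u : ℝ → ℝ → ℝ → ℝ} {x y t a b c : ℝ} (h : Reg u (x + a) (y + b) (t + c)) :
    Reg (sh u a b c) x y t := by
  constructor
  · exact aux_shift h.dx
  · exact aux_shift h.dy
  · exact aux_shift h.dt
  · rw [sh_pdx]; exact aux_shift h.dxx
  · rw [sh_pdy]; exact aux_shift h.dyy
  · have h2 : ContinuousAt (fun q : ℝ × ℝ × ℝ => (q.1 + a, q.2.1 + b, q.2.2 + c)) (x, y, t) := by
      fun_prop
    exact ContinuousAt.comp (x := (x, y, t)) (g := fun q : ℝ × ℝ × ℝ => u q.1 q.2.1 q.2.2) h.ct h2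

lemma comb_deriv {f g h : ℝ → ℝ} {x : ℝ} (hf : DifferentiableAt ℝ f x) (hg : DifferentiableAt ℝ g x)
    (hh : DifferentiableAt ℝ h x) :
    deriv (fun s => f s - (g s + h s) / 2) x = deriv f x - (deriv g x + deriv h x) / 2 :=
  (hf.hasDerivAt.sub ((hg.hasDerivAt.add hh.hasDerivAt).div_const 2)).deriv

/-- general comparison -/
lemma aux_comp (p L T : ℝ) (hp : 2 < p) (hL : 0 < L) (u : ℝ → ℝ → ℝ → ℝ)
    (hsol : ClassicalSolution p L T u) (a1 a2 a3 b1 b2 b3 c1 c2 c3 t0 t1 c : ℝ)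
    (ha1 : |a1| ≤ L / 8) (ha2 : |a2| ≤ L / 8) (ha3 : |a3| ≤ L / 8)
    (hb1 : 0 ≤ b1 ∧ b1 ≤ L / 8) (hb2 : 0 ≤ b2 ∧ b2 ≤ L / 8) (hb3 : 0 ≤ b3 ∧ b3 ≤ L / 8)
    (hc1 : 0 ≤ c1 ∧ t1 + c1 < T) (hc2 : 0 ≤ c2 ∧ t1 + c2 < T) (hc3 : 0 ≤ c3 ∧ t1 + c3 < T)
    (ht0 : 0 < t0)
    (hb : ∀ x ∈ Icc (-(L/4)) (L/4), ∀ y ∈ Icc 0 (L/4), ∀ t ∈ Icc t0 t1,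
      (x = -(L/4) ∨ x = L/4 ∨ y = 0 ∨ y = L/4 ∨ t = t0) →
      u (x + a1) (y + b1) (t + c1) -
        (u (x + a2) (y + b2) (t + c2) + u (x + a3) (y + b3) (t + c3)) / 2 ≤ c) :
    ∀ x ∈ Icc (-(L/4)) (L/4), ∀ y ∈ Icc 0 (L/4), ∀ t ∈ Icc t0 t1,
      u (x + a1) (y + b1) (t + c1) -
        (u (x + a2) (y + b2) (t + c2) + u (x + a3) (y + b3) (t + c3)) / 2 ≤ c := by
  have key : ∀ a b c : ℝ, |a| ≤ L / 8 → (0 ≤ b ∧ b ≤ L / 8) → (0 ≤ c ∧ t1 + c < T) →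
      (∀ x ∈ Icc (-(L/4)) (L/4), ∀ y ∈ Icc 0 (L/4), ∀ t ∈ Icc t0 t1, Reg (sh u a b c) x y t) ∧
      (∀ x ∈ Ioo (-(L/4)) (L/4), ∀ y ∈ Ioo 0 (L/4), ∀ t ∈ Icc t0 t1,
        pdt (sh u a b c) x y t - (pdxx (sh u a b c) x y t + pdyy (sh u a b c) x y t) =
        Real.sqrt ((pdx (sh u a b c) x y t) ^ 2 + (pdy (sh u a b c) x y t) ^ 2) ^ p) := by
    intro a b c ha hb hc
    obtain ⟨ha1, ha2⟩ := abs_le.1 ha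
    constructor
    · intro x hx y hy t ht
      apply Reg.sh
      apply C21At.reg
      refine hsol.smooth (abs_le.2 ⟨?_, ?_⟩) ⟨?_, ?_⟩ ⟨?_, ?_⟩ <;>
        linarith [hx.1, hx.2, hy.1, hy.2, ht.1, ht.2]
    · intro x hx y hy t ht
      rw [pdxx_def, pdyy_def, sh_pdt, sh_pdx, sh_pdy, sh_pdx, sh_pdy]
      refine hsol.pde (abs_lt.2 ⟨?_, ?_⟩) ⟨?_, ?_⟩ ⟨?_, ?_⟩ <;>
        linarith [hx.1, hx.2, hy.1, hy.2, ht.1, ht.2]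
  obtain ⟨r1, q1⟩ := key a1 b1 c1 ha1 hb1 hc1
  obtain ⟨r2, q2⟩ := key a2 b2 c2 ha2 hb2 hc2
  obtain ⟨r3, q3⟩ := key a3 b3 c3 ha3 hb3 hc3
  change ∀ x ∈ Icc (-(L/4)) (L/4), ∀ y ∈ Icc 0 (L/4), ∀ t ∈ Icc t0 t1,
      (fun x y t => sh u a1 b1 c1 x y t - (sh u a2 b2 c2 x y t + sh u a3 b3 c3 x y t) / 2) x y t ≤ c
  change ∀ x ∈ Icc (-(L/4)) (L/4), ∀ y ∈ Icc 0 (L/4), ∀ t ∈ Icc t0 t1,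
      (x = -(L/4) ∨ x = L/4 ∨ y = 0 ∨ y = L/4 ∨ t = t0) →
      sh u a1 b1 c1 x y t - (sh u a2 b2 c2 x y t + sh u a3 b3 c3 x y t) / 2 ≤ c at hb
  generalize sh u a1 b1 c1 = f1 at *
  generalize sh u a2 b2 c2 = f2 at *
  generalize sh u a3 b3 c3 = f3 at *
  apply aux_maxp
  · rintro ⟨x, y, t⟩ ⟨hx, hy, ht⟩
    apply ContinuousAt.continuousWithinAt
    exact (r1 x hx y hy t ht).ct.sub
      (((r2 x hx y hy t ht).ct.add (r3 x hx y hy t ht).ct).div_const 2)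
  · intro x hx y hy t ht
    have hx' := Ioo_subset_Icc_self hx
    have hy' := Ioo_subset_Icc_self hy
    have ht' := Ioc_subset_Icc_self ht
    have s1 := r1 x hx' y hy' t ht'
    have s2 := r2 x hx' y hy' t ht'
    have s3 := r3 x hx' y hy' t ht'
    refine ⟨s1.dx.continuousAt.sub ((s2.dx.continuousAt.add s3.dx.continuousAt).div_const 2),
      s1.dy.continuousAt.sub ((s2.dy.continuousAt.add s3.dy.continuousAt).div_const 2),
      s1.dt.sub ((s2.dt.add s3.dt).div_const 2), ?_⟩
    intro g1 g2
    have e1 : ∀ s ∈ Ioo (-(L/4)) (L/4), pdx (fun x y t => f1 x y t - (f2 x y t + f3 x y t) / 2) s y t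
        = pdx f1 s y t - (pdx f2 s y t + pdx f3 s y t) / 2 := fun s hs =>
      have hs' := Ioo_subset_Icc_self hs
      comb_deriv (r1 s hs' y hy' t ht').dx (r2 s hs' y hy' t ht').dx (r3 s hs' y hy' t ht').dx
    have e2 : ∀ s ∈ Ioo 0 (L/4), pdy (fun x y t => f1 x y t - (f2 x y t + f3 x y t) / 2) x s t
        = pdy f1 x s t - (pdy f2 x s t + pdy f3 x s t) / 2 := fun s hs =>
      have hs' := Ioo_subset_Icc_self hs
      comb_deriv (r1 x hx' s hs' t ht').dy (r2 x hx' s hs' t ht').dy (r3 x hx' s hs' t ht').dy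
    have e3 : pdt (fun x y t => f1 x y t - (f2 x y t + f3 x y t) / 2) x y t
        = pdt f1 x y t - (pdt f2 x y t + pdt f3 x y t) / 2 := comb_deriv s1.dt s2.dt s3.dt
    have e4 : pdxx (fun x y t => f1 x y t - (f2 x y t + f3 x y t) / 2) x y t
        = pdxx f1 x y t - (pdxx f2 x y t + pdxx f3 x y t) / 2 := by
      rw [← show _ = pdxx f1 x y t - (pdxx f2 x y t + pdxx f3 x y t) / 2 from
        comb_deriv s1.dxx s2.dxx s3.dxx]
      apply Filter.EventuallyEq.deriv_eq
      filter_upwards [Ioo_mem_nhds hx.1 hx.2] with s hs using e1 s hs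
    have e5 : pdyy (fun x y t => f1 x y t - (f2 x y t + f3 x y t) / 2) x y t
        = pdyy f1 x y t - (pdyy f2 x y t + pdyy f3 x y t) / 2 := by
      rw [← show _ = pdyy f1 x y t - (pdyy f2 x y t + pdyy f3 x y t) / 2 from
        comb_deriv s1.dyy s2.dyy s3.dyy]
      apply Filter.EventuallyEq.deriv_eq
      filter_upwards [Ioo_mem_nhds hy.1 hy.2] with s hs using e2 s hs
    rw [e1 x hx] at g1
    rw [e2 y hy] at g2
    rw [e3, e4, e5]
    have p1 := q1 x hx y hy t ht'
    have p2 := q2 x hx y hy t ht'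
    have p3 := q3 x hx y hy t ht'
    have g1' : pdx f1 x y t = (pdx f2 x y t + pdx f3 x y t) / 2 := by linarith
    have g2' : pdy f1 x y t = (pdy f2 x y t + pdy f3 x y t) / 2 := by linarith
    rw [g1', g2'] at p1
    have := aux_conv hp (pdx f2 x y t) (pdy f2 x y t) (pdx f3 x y t) (pdy f3 x y t)
    linarith
  · intro x hx y hy t ht h
    exact hb x hx y hy t ht h

lemma aux_lip {f : ℝ → ℝ} {a b M : ℝ} (h : ∀ s ∈ uIcc a b, DifferentiableAt ℝ f s ∧ |deriv f s| ≤ M) :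
    |f b - f a| ≤ M * |b - a| :=
  Convex.norm_image_sub_le_of_norm_deriv_le (s := uIcc a b) (fun s hs => (h s hs).1)
    (fun s hs => (h s hs).2) (convex_uIcc a b) left_mem_uIcc right_mem_uIcc

lemma aux_bnd (L T : ℝ) (u : ℝ → ℝ → ℝ → ℝ) (hext : ExtC21 L T u) (τ r : ℝ)
    (hτ : τ < T) (hr : 0 < r) : ∃ M : ℝ, 0 ≤ M ∧ ∀ x y t : ℝ, |x| ≤ L / 2 → y ∈ Icc 0 (L / 2) →
      t ∈ Icc (T / 2) T → (r ≤ |x| ∨ r ≤ y ∨ t ≤ τ) → Reg u x y t ∧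
      |pdx u x y t| ≤ M ∧ |pdy u x y t| ≤ M ∧ |pdt u x y t| ≤ M ∧ |pdxx u x y t| ≤ M := by
  set S : Set (ℝ × ℝ × ℝ) := (Icc (-(L/2)) (L/2) ×ˢ Icc 0 (L/2) ×ˢ Icc (T/2) T) ∩
    {q | r ≤ |q.1| ∨ r ≤ q.2.1 ∨ q.2.2 ≤ τ} with hS
  have hSc : IsCompact S := by
    apply (isCompact_Icc.prod (isCompact_Icc.prod isCompact_Icc)).inter_right
    have k1 : IsClosed {q : ℝ × ℝ × ℝ | r ≤ |q.1|} := isClosed_le continuous_const (by fun_prop)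
    have k2 : IsClosed {q : ℝ × ℝ × ℝ | r ≤ q.2.1} := isClosed_le continuous_const (by fun_prop)
    have k3 : IsClosed {q : ℝ × ℝ × ℝ | q.2.2 ≤ τ} := isClosed_le (by fun_prop) continuous_const
    exact k1.union (k2.union k3)
  have hC : ∀ q ∈ S, C21At u q.1 q.2.1 q.2.2 := by
    rintro ⟨x, y, t⟩ ⟨⟨hx, hy, ht⟩, h⟩
    refine hext (abs_le.2 hx) hy ht ?_
    rintro ⟨rfl, rfl, rfl⟩
    simp only [mem_ofPred_eq, abs_zero] at h
    rcases h with h | h | h <;> linarith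
  obtain ⟨M1, h1⟩ := hSc.exists_bound_of_continuousOn (f := fun q => pdx u q.1 q.2.1 q.2.2)
    (fun q hq => (hC q hq).2.2.2.2.2.2.2.1.continuousWithinAt)
  obtain ⟨M2, h2⟩ := hSc.exists_bound_of_continuousOn (f := fun q => pdy u q.1 q.2.1 q.2.2)
    (fun q hq => (hC q hq).2.2.2.2.2.2.2.2.1.continuousWithinAt)
  obtain ⟨M3, h3⟩ := hSc.exists_bound_of_continuousOn (f := fun q => pdt u q.1 q.2.1 q.2.2)
    (fun q hq => (hC q hq).2.2.2.2.2.2.2.2.2.1.continuousWithinAt)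
  obtain ⟨M4, h4⟩ := hSc.exists_bound_of_continuousOn (f := fun q => pdxx u q.1 q.2.1 q.2.2)
    (fun q hq => (hC q hq).2.2.2.2.2.2.2.2.2.2.1.continuousWithinAt)
  refine ⟨|M1| + |M2| + |M3| + |M4|, by positivity, ?_⟩
  intro x y t hx hy ht h
  have hq : (x, y, t) ∈ S := ⟨⟨abs_le.1 hx, hy, ht⟩, h⟩
  have g1 := h1 _ hq
  have g2 := h2 _ hq
  have g3 := h3 _ hq
  have g4 := h4 _ hq
  simp only [Real.norm_eq_abs] at g1 g2 g3 g4
  have := abs_nonneg M1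
  have := abs_nonneg M2
  have := abs_nonneg M3
  have := abs_nonneg M4
  refine ⟨(hC _ hq).reg, ?_, ?_, ?_, ?_⟩ <;>
    linarith [le_abs_self M1, le_abs_self M2, le_abs_self M3, le_abs_self M4]

lemma aux_ut (p L T : ℝ) (hp : 2 < p) (hL : 0 < L) (hT : 0 < T) (u : ℝ → ℝ → ℝ → ℝ)
    (hsol : ClassicalSolution p L T u) (hext : ExtC21 L T u) :
    ∃ M : ℝ, 0 ≤ M ∧ ∀ x ∈ Icc (-(L/4)) (L/4), ∀ y ∈ Icc 0 (L/4), ∀ t ∈ Ico (T/2) T,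
      -M ≤ pdt u x y t := by
  obtain ⟨M, hM, hB⟩ := aux_bnd L T u hext (3 * T / 4) (L / 8) (by linarith) (by linarith)
  refine ⟨M, hM, ?_⟩
  intro x hx y hy t ht
  have hx' := abs_le.2 hx
  have hreg : Reg u x y t := (hsol.smooth (by linarith) ⟨hy.1, by linarith [hy.2]⟩
    ⟨by linarith [ht.1], ht.2⟩).reg
  have : deriv (fun s => -u x y s) t ≤ M := by
    refine aux_deriv_le (r := min (T - t) (T / 4)) hreg.dt.neg
      (lt_min (by linarith [ht.2]) (by linarith)) ?_
    intro h hh0 hh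
    have hh1 := lt_of_lt_of_le hh (min_le_left _ _)
    have hh2 := lt_of_lt_of_le hh (min_le_right _ _)
    have L8 : |(0:ℝ)| ≤ L / 8 := by rw [abs_zero]; linarith
    have L8' : (0:ℝ) ≤ 0 ∧ 0 ≤ L / 8 := ⟨le_rfl, by linarith⟩
    have := aux_comp p L T hp hL u hsol 0 0 0 0 0 0 0 h h (T/2) t (M * h) L8 L8 L8 L8' L8' L8'
      ⟨le_rfl, by linarith [ht.2]⟩ ⟨hh0.le, by linarith⟩ ⟨hh0.le, by linarith⟩ (by linarith) ?_
      x hx y hy t ⟨ht.1, le_rfl⟩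
    · simp only [add_zero] at this
      linarith
    · intro X hX Y hY S hS hbd
      simp only [add_zero]
      by_cases hY0 : Y = 0
      · have hXL : |X| < L := by have := abs_le.2 hX; linarith
        rw [hY0, hsol.bc hXL ⟨by linarith [hS.1], by linarith [hS.2]⟩,
          hsol.bc hXL ⟨by linarith [hS.1], by linarith [hS.2]⟩]
        have := mul_nonneg hM hh0.le
        linarith
      · have key : |u X Y (S + h) - u X Y S| ≤ M * |S + h - S| := by
          refine aux_lip (f := fun s => u X Y s) ?_
          intro s hs
          rw [uIcc_of_le (by linarith)] at hs
          have hb := hB X Y s (by have := abs_le.2 hX; linarith) ⟨hY.1, by linarith [hY.2]⟩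
            ⟨by linarith [hS.1, hs.1], by linarith [hs.2, hS.2]⟩ ?_
          · exact ⟨hb.1.dt, hb.2.2.2.1⟩
          · rcases hbd with h | h | h | h | h
            · left; rw [h, abs_neg, abs_of_pos (by linarith)]; linarith
            · left; rw [h, abs_of_pos (by linarith)]; linarith
            · exact absurd h hY0
            · right; left; linarith
            · right; right; linarith [hs.2]
        rw [add_sub_cancel_left, abs_of_pos hh0] at key
        have := (abs_le.1 key).1
        linarith
  have e : deriv (fun s => -u x y s) t = - pdt u x y t := hreg.dt.hasDerivAt.neg.deriv
  linarith

lemma aux_second_diff {f : ℝ → ℝ} {x h M : ℝ} (hh : 0 < h)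
    (H : ∀ s ∈ Icc (x - h) (x + h), DifferentiableAt ℝ f s ∧ DifferentiableAt ℝ (deriv f) s ∧
      |deriv (deriv f) s| ≤ M) : f x - (f (x + h) + f (x - h)) / 2 ≤ M * h ^ 2 := by
  obtain ⟨ξ, hξ, e1⟩ := exists_deriv_eq_slope f (show x < x + h by linarith)
    (fun s hs => (H s ⟨by linarith [hs.1], hs.2⟩).1.continuousAt.continuousWithinAt)
    (fun s hs => (H s ⟨by linarith [hs.1], hs.2.le⟩).1.differentiableWithinAt)
  obtain ⟨ζ, hζ, e2⟩ := exists_deriv_eq_slope f (show x - h < x by linarith)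
    (fun s hs => (H s ⟨hs.1, by linarith [hs.2]⟩).1.continuousAt.continuousWithinAt)
    (fun s hs => (H s ⟨hs.1.le, by linarith [hs.2]⟩).1.differentiableWithinAt)
  have hlip : |deriv f ξ - deriv f ζ| ≤ M * |ξ - ζ| := by
    apply aux_lip
    intro s hs
    rw [uIcc_of_le (by linarith [hξ.1, hζ.2])] at hs
    exact (H s ⟨by linarith [hs.1, hζ.1], by linarith [hs.2, hξ.2]⟩).2
  have hM : 0 ≤ M := le_trans (abs_nonneg _) (H x ⟨by linarith, by linarith⟩).2.2
  rw [abs_of_pos (show 0 < ξ - ζ by linarith [hξ.1, hζ.2])] at hlip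
  have h3 : M * (ξ - ζ) ≤ M * (2 * h) :=
    mul_le_mul_of_nonneg_left (by linarith [hξ.2, hζ.1]) hM
  have h4 := (abs_le.1 (hlip.trans h3)).1
  rw [e1, e2, add_sub_cancel_left, sub_sub_cancel, ← sub_div, le_div_iff₀ hh] at h4
  nlinarith

lemma aux_uxx (p L T : ℝ) (hp : 2 < p) (hL : 0 < L) (hT : 0 < T) (u : ℝ → ℝ → ℝ → ℝ)
    (hsol : ClassicalSolution p L T u) (hext : ExtC21 L T u) :
    ∃ M : ℝ, 0 ≤ M ∧ ∀ x ∈ Icc (-(L/4)) (L/4), ∀ y ∈ Icc 0 (L/4), ∀ t ∈ Ico (T/2) T,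
      -M ≤ pdxx u x y t := by
  obtain ⟨M, hM, hB⟩ := aux_bnd L T u hext (3 * T / 4) (L / 8) (by linarith) (by linarith)
  refine ⟨2 * M, by linarith, ?_⟩
  intro x hx y hy t ht
  have hx' := abs_le.2 hx
  have hreg : ∀ s, |s| ≤ L → Reg u s y t := fun s hs => (hsol.smooth hs ⟨hy.1, by linarith [hy.2]⟩
    ⟨by linarith [ht.1], ht.2⟩).reg
  have main : ∀ h, 0 < h → h ≤ L / 8 → u x y t - (u (x + h) y t + u (x - h) y t) / 2 ≤ M * h ^ 2 := by
    intro h hh0 hh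
    have L8 : |(0:ℝ)| ≤ L / 8 := by rw [abs_zero]; linarith
    have L8h : |h| ≤ L / 8 := by rw [abs_of_pos hh0]; linarith
    have L8h' : |-h| ≤ L / 8 := by rw [abs_neg]; exact L8h
    have L8' : (0:ℝ) ≤ 0 ∧ 0 ≤ L / 8 := ⟨le_rfl, by linarith⟩
    have htT : 0 ≤ (0:ℝ) ∧ t + 0 < T := ⟨le_rfl, by linarith [ht.2]⟩
    have := aux_comp p L T hp hL u hsol 0 h (-h) 0 0 0 0 0 0 (T/2) t (M * h ^ 2) L8 L8h L8h' L8' L8' L8'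
      htT htT htT (by linarith) ?_ x hx y hy t ⟨ht.1, le_rfl⟩
    · simpa only [add_zero, ← sub_eq_add_neg] using this
    · intro X hX Y hY S hS hbd
      simp only [add_zero, ← sub_eq_add_neg]
      by_cases hY0 : Y = 0
      · have hXL := abs_le.2 hX
        have hS0 : S ∈ Ioo 0 T := ⟨by linarith [hS.1], by linarith [hS.2, ht.2]⟩
        rw [hY0, hsol.bc (by linarith) hS0,
          hsol.bc (abs_lt.2 ⟨by linarith [hX.1], by linarith [hX.2]⟩) hS0,
          hsol.bc (abs_lt.2 ⟨by linarith [hX.1], by linarith [hX.2]⟩) hS0]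
        have := mul_nonneg hM (sq_nonneg h)
        linarith
      · refine aux_second_diff (f := fun s => u s Y S) hh0 ?_
        intro s hs
        have hb := hB s Y S (abs_le.2 ⟨by linarith [hX.1, hs.1], by linarith [hX.2, hs.2]⟩)
          ⟨hY.1, by linarith [hY.2]⟩
          ⟨by linarith [hS.1, hs.1], by linarith [hS.2, ht.2]⟩ ?_
        · exact ⟨hb.1.dx, hb.1.dxx, hb.2.2.2.2⟩
        · rcases hbd with h | h | h | h | h
          · left; rw [abs_of_neg (by linarith [hs.2])]; linarith [hs.2]
          · left; rw [abs_of_pos (by linarith [hs.1])]; linarith [hs.1]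
          · exact absurd h hY0
          · right; left; linarith
          · right; right; linarith
  -- second derivative test
  have hs : ∀ k, |k| ≤ L / 8 → |x + k| ≤ L ∧ |x - k| ≤ L := fun k hk =>
    ⟨(abs_add_le _ _).trans (by linarith), (abs_sub _ _).trans (by linarith)⟩
  set g : ℝ → ℝ := fun k => -(u (x + k) y t + u (x - k) y t + 2 * M * k ^ 2) with hg
  have hd : ∀ k, |k| ≤ L / 8 → HasDerivAt g
      (-(pdx u (x + k) y t - pdx u (x - k) y t + 4 * M * k)) k := by
    intro k hk
    have h1 : HasDerivAt (fun k => u (x + k) y t) (pdx u (x + k) y t) k :=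
      HasDerivAt.comp_const_add x k (hreg _ (hs k hk).1).dx.hasDerivAt
    have h2 : HasDerivAt (fun k => u (x - k) y t) (-pdx u (x - k) y t) k :=
      HasDerivAt.comp_const_sub x k (hreg _ (hs k hk).2).dx.hasDerivAt
    have h3 : HasDerivAt (fun k : ℝ => 2 * M * k ^ 2) (2 * M * (2 * k)) k := by
      simpa using (hasDerivAt_pow 2 k).const_mul (2 * M)
    have h4 := ((h1.add h2).add h3).neg
    have e : -(pdx u (x + k) y t - pdx u (x - k) y t + 4 * M * k) =
      -(pdx u (x + k) y t + -pdx u (x - k) y t + 2 * M * (2 * k)) := by ring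
    rw [e]
    exact h4
  have hmax : IsLocalMax g 0 := by
    filter_upwards [Icc_mem_nhds (show -(L/8) < 0 by linarith) (show 0 < L/8 by linarith)] with k hk
    simp only [hg, add_zero, sub_zero]
    rcases lt_trichotomy k 0 with h | h | h
    · have := main (-k) (by linarith) (by linarith [hk.1])
      rw [← sub_eq_add_neg, sub_neg_eq_add, neg_sq] at this
      linarith
    · subst h; simp
    · have := main k h hk.2
      linarith
  have h0 : |(0:ℝ)| ≤ L / 8 := by rw [abs_zero]; linarith
  have h2 := aux_second (hd 0 h0).continuousAt hmax
  have e : deriv (deriv g) 0 = -(2 * pdxx u x y t + 4 * M) := by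
    have : deriv g =ᶠ[nhds 0] fun k => -(pdx u (x + k) y t - pdx u (x - k) y t + 4 * M * k) := by
      filter_upwards [Icc_mem_nhds (show -(L/8) < 0 by linarith) (show 0 < L/8 by linarith)] with k hk
      exact (hd k (abs_le.2 hk)).deriv
    rw [this.deriv_eq]
    have h1 : HasDerivAt (fun k => pdx u (x + k) y t) (pdxx u x y t) 0 := by
      refine HasDerivAt.comp_const_add (f := fun s => pdx u s y t) x 0 ?_
      rw [add_zero]
      exact (hreg _ (by linarith)).dxx.hasDerivAt
    have h2 : HasDerivAt (fun k => pdx u (x - k) y t) (-pdxx u x y t) 0 := by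
      refine HasDerivAt.comp_const_sub (f := fun s => pdx u s y t) x 0 ?_
      rw [sub_zero]
      exact (hreg _ (by linarith)).dxx.hasDerivAt
    have h3 : HasDerivAt (fun k : ℝ => 4 * M * k) (4 * M) 0 := by
      simpa using (hasDerivAt_id (0:ℝ)).const_mul (4 * M)
    refine Eq.trans ((h1.sub h2).add h3).neg.deriv ?_
    ring
  linarith

lemma aux_mono (p L T : ℝ) (u : ℝ → ℝ → ℝ → ℝ)
    (hsol : ClassicalSolution p L T u) (hmon : MonCond L T u) {x y t : ℝ} (hx : |x| < L)
    (hy : y ∈ Ico 0 L) (ht : t ∈ Ioo 0 T) : u x y t ≤ u 0 y t := by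
  have hL : 0 < L := lt_of_le_of_lt (abs_nonneg _) hx
  obtain ⟨hx1, hx2⟩ := abs_lt.1 hx
  rcases hy.1.eq_or_lt with h0 | hy0
  · rw [← h0, hsol.bc hx ht, hsol.bc (by simpa using hL) ht]
  · have hd : ∀ s, |s| < L → DifferentiableAt ℝ (fun s => u s y t) s := fun s hs =>
      (hsol.smooth hs.le ⟨hy.1, hy.2.le⟩ ht).1
    rcases le_total 0 x with h | h
    · have : AntitoneOn (fun s => u s y t) (Icc 0 x) := by
        apply antitoneOn_of_deriv_nonpos (convex_Icc _ _)
        · intro s hs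
          exact (hd s (abs_lt.2 ⟨by linarith [hs.1], by linarith [hs.2]⟩)).continuousAt.continuousWithinAt
        · intro s hs
          rw [interior_Icc] at hs
          exact (hd s (abs_lt.2 ⟨by linarith [hs.1], by linarith [hs.2]⟩)).differentiableWithinAt
        · intro s hs
          rw [interior_Icc] at hs
          have := hmon (abs_lt.2 ⟨by linarith [hs.1], by linarith [hs.2]⟩) ⟨hy0, hy.2⟩ ht (x := s)
          exact nonpos_of_mul_nonpos_right this hs.1
      exact this (left_mem_Icc.2 h) (right_mem_Icc.2 h) h
    · have : MonotoneOn (fun s => u s y t) (Icc x 0) := by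
        apply monotoneOn_of_deriv_nonneg (convex_Icc _ _)
        · intro s hs
          exact (hd s (abs_lt.2 ⟨by linarith [hs.1], by linarith [hs.2]⟩)).continuousAt.continuousWithinAt
        · intro s hs
          rw [interior_Icc] at hs
          exact (hd s (abs_lt.2 ⟨by linarith [hs.1], by linarith [hs.2]⟩)).differentiableWithinAt
        · intro s hs
          rw [interior_Icc] at hs
          have h := hmon (abs_lt.2 ⟨by linarith [hs.1], by linarith [hs.2]⟩) ⟨hy0, hy.2⟩ ht (x := s)
          change 0 ≤ pdx u s y t
          by_contra hn
          push Not at hn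
          have := mul_pos_of_neg_of_neg hs.2 hn
          linarith
      exact this (left_mem_Icc.2 h) (right_mem_Icc.2 h) h

lemma aux_max0 (p L T : ℝ) (hL : 0 < L) (u : ℝ → ℝ → ℝ → ℝ)
    (hsol : ClassicalSolution p L T u) (hmon : MonCond L T u) {y t : ℝ}
    (hy : y ∈ Ico 0 L) (ht : t ∈ Ioo 0 T) : pdx u 0 y t = 0 ∧ pdxx u 0 y t ≤ 0 := by
  have m : IsLocalMax (fun s => u s y t) 0 := by
    filter_upwards [Ioo_mem_nhds (show -L < 0 by linarith) hL] with s hs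
    exact aux_mono p L T u hsol hmon (abs_lt.2 hs) hy ht
  refine ⟨m.deriv_eq_zero, aux_second ?_ m⟩
  exact (hsol.smooth (by rw [abs_zero]; exact hL.le) ⟨hy.1, hy.2.le⟩ ht).1.continuousAt

lemma aux_quad {f : ℝ → ℝ} {x M R : ℝ} (hM : 0 ≤ M) (hx : |x| ≤ R)
    (hd : ∀ s ∈ Icc (-R) R, DifferentiableAt ℝ f s ∧ DifferentiableAt ℝ (deriv f) s ∧
      -M ≤ deriv (deriv f) s) (h0 : deriv f 0 = 0) : f 0 ≤ f x + M * x ^ 2 := by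
  have hR : 0 ≤ R := (abs_nonneg x).trans hx
  obtain ⟨hx1, hx2⟩ := abs_le.1 hx
  have hDh : ∀ s ∈ Icc (-R) R, HasDerivAt (fun s => deriv f s + M * s) (deriv (deriv f) s + M) s := by
    intro s hs
    have h3 : HasDerivAt (fun k : ℝ => M * k) M s := by
      simpa using (hasDerivAt_id s).const_mul M
    exact (hd s hs).2.1.hasDerivAt.add h3
  have hmono : MonotoneOn (fun s => deriv f s + M * s) (Icc (-R) R) := by
    apply monotoneOn_of_deriv_nonneg (convex_Icc _ _)
    · intro s hs
      exact (hDh s hs).continuousAt.continuousWithinAt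
    · intro s hs
      exact (hDh s (interior_subset hs)).differentiableAt.differentiableWithinAt
    · intro s hs
      rw [(hDh s (interior_subset hs)).deriv]
      linarith [(hd s (interior_subset hs)).2.2]
  have hDg : ∀ s ∈ Icc (-R) R, HasDerivAt (fun s => f s + M / 2 * s ^ 2) (deriv f s + M * s) s := by
    intro s hs
    have h3 : HasDerivAt (fun k : ℝ => M / 2 * k ^ 2) (M * s) s := by
      have e : M * s = M / 2 * (2 * s) := by ring
      rw [e]
      simpa using (hasDerivAt_pow 2 s).const_mul (M / 2)
    exact (hd s hs).1.hasDerivAt.add h3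
  have z : (0:ℝ) ∈ Icc (-R) R := ⟨by linarith, hR⟩
  have hMx := mul_nonneg hM (sq_nonneg x)
  rcases le_total 0 x with h | h
  · have hsub : Icc 0 x ⊆ Icc (-R) R := Icc_subset_Icc (by linarith) hx2
    have : MonotoneOn (fun s => f s + M / 2 * s ^ 2) (Icc 0 x) := by
      apply monotoneOn_of_deriv_nonneg (convex_Icc _ _)
      · intro s hs
        exact (hDg s (hsub hs)).continuousAt.continuousWithinAt
      · intro s hs
        exact (hDg s (hsub (interior_subset hs))).differentiableAt.differentiableWithinAt
      · intro s hs
        have hs := interior_subset hs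
        rw [(hDg s (hsub hs)).deriv]
        have := hmono z (hsub hs) hs.1
        simpa [h0] using this
    have := this (left_mem_Icc.2 h) (right_mem_Icc.2 h) h
    simp only at this
    nlinarith
  · have hsub : Icc x 0 ⊆ Icc (-R) R := Icc_subset_Icc hx1 hR
    have : AntitoneOn (fun s => f s + M / 2 * s ^ 2) (Icc x 0) := by
      apply antitoneOn_of_deriv_nonpos (convex_Icc _ _)
      · intro s hs
        exact (hDg s (hsub hs)).continuousAt.continuousWithinAt
      · intro s hs
        exact (hDg s (hsub (interior_subset hs))).differentiableAt.differentiableWithinAt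
      · intro s hs
        have hs := interior_subset hs
        rw [(hDg s (hsub hs)).deriv]
        have := hmono (hsub hs) z hs.2
        simpa [h0] using this
    have := this (left_mem_Icc.2 h) (right_mem_Icc.2 h) h
    simp only at this
    nlinarith

lemma aux_ctT {L T : ℝ} (hT : 0 < T) {u : ℝ → ℝ → ℝ → ℝ} (hext : ExtC21 L T u) {x y : ℝ}
    (hx : |x| ≤ L / 2) (hy : y ∈ Ioc 0 (L / 2)) : ContinuousAt (fun t => u x y t) T := by
  refine (hext hx ⟨hy.1.le, hy.2⟩ ⟨by linarith, le_rfl⟩ ?_).2.2.1.continuousAt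
  rintro ⟨-, h, -⟩
  exact hy.1.ne' h

lemma aux_low (p L T : ℝ) (hp : 2 < p) (hL : 0 < L) (hT : 0 < T) (u : ℝ → ℝ → ℝ → ℝ)
    (hsol : ClassicalSolution p L T u) (hext : ExtC21 L T u) (hmon : MonCond L T u) :
    ∃ M : ℝ, 0 ≤ M ∧ ∀ x y : ℝ, |x| ≤ L / 4 → y ∈ Ioc 0 (L/4) →
      u 0 y T ≤ u x y T + M * x ^ 2 := by
  obtain ⟨M, hM, hB⟩ := aux_uxx p L T hp hL hT u hsol hext
  refine ⟨M, hM, fun x y hx hy => ?_⟩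
  have c0 := aux_ctT hT hext (x := 0) (y := y) (by rw [abs_zero]; linarith) ⟨hy.1, by linarith [hy.2]⟩
  have c1 := aux_ctT hT hext (x := x) (y := y) (by linarith) ⟨hy.1, by linarith [hy.2]⟩
  refine le_of_tendsto_of_tendsto (b := nhdsWithin T (Iio T)) c0.continuousWithinAt
    (c1.continuousWithinAt.add_const (M * x ^ 2)) ?_
  filter_upwards [Ioo_mem_nhdsLT (show T / 2 < T by linarith)] with t ht
  have ht' : t ∈ Ioo 0 T := ⟨by linarith [ht.1], ht.2⟩
  refine aux_quad (f := fun s => u s y t) (R := L / 4) hM hx ?_ ?_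
  · intro s hs
    have hr := (hsol.smooth (x := s) (by have := abs_le.2 hs; linarith)
      ⟨hy.1.le, by linarith [hy.2]⟩ ht').reg
    exact ⟨hr.dx, hr.dxx, hB s hs y ⟨hy.1.le, hy.2⟩ t ⟨ht.1.le, ht.2⟩⟩
  · exact (aux_max0 p L T hL u hsol hmon ⟨hy.1.le, by linarith [hy.2]⟩ ht').1

lemma aux_blow (p L T : ℝ) (hp : 2 < p) (hL : 0 < L) (hT : 0 < T) (u : ℝ → ℝ → ℝ → ℝ)
    (hsol : ClassicalSolution p L T u) (hgbu : IsolatedGBU L T u) (hext : ExtC21 L T u)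
    (hmon : MonCond L T u) (N δ : ℝ) (hδ : 0 < δ) (hδL : δ ≤ L / 8) :
    ∃ y ∈ Ioo 0 δ, ∃ t ∈ Ioo (T - δ) T, 0 < t ∧ N < pdy u 0 y t := by
  by_contra hcon
  push Not at hcon
  set t0 := max (T / 2) (T - δ / 2) with ht0
  have ht01 : T / 2 ≤ t0 := le_max_left _ _
  have ht02 : T - δ / 2 ≤ t0 := le_max_right _ _
  have ht03 : t0 < T := max_lt (by linarith) (by linarith)
  obtain ⟨M, hM, hB⟩ := aux_bnd L T u hext t0 (L / 8) ht03 (by linarith)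
  set C := M + |N| with hC
  have hN0 := abs_nonneg N
  have hC0 : 0 ≤ C := by linarith
  -- linear bound at x = 0
  have hlin : ∀ y ∈ Ico 0 δ, ∀ t ∈ Ico t0 T, u 0 y t ≤ C * y := by
    intro y hy t ht
    have htT : t ∈ Ioo 0 T := ⟨by linarith [ht.1], ht.2⟩
    rcases hy.1.eq_or_lt with h | h
    · rw [← h, hsol.bc (by rw [abs_zero]; exact hL) htT]; simp
    · have hd : ∀ s ∈ Icc 0 y, DifferentiableAt ℝ (fun s => u 0 s t) s := fun s hs =>
        (hsol.smooth (by rw [abs_zero]; exact hL.le) ⟨hs.1, by linarith [hs.2, hy.2]⟩ htT).2.1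
      obtain ⟨ξ, hξ, e⟩ := exists_deriv_eq_slope (fun s => u 0 s t) h
        (fun s hs => (hd s hs).continuousAt.continuousWithinAt)
        (fun s hs => (hd s ⟨hs.1.le, hs.2.le⟩).differentiableWithinAt)
      have h2 : deriv (fun s => u 0 s t) ξ ≤ N := hcon ξ ⟨hξ.1, by linarith [hξ.2, hy.2]⟩ t
        ⟨by linarith [ht.1], ht.2⟩ htT.1
      rw [e, hsol.bc (by rw [abs_zero]; exact hL) htT, sub_zero, sub_zero, div_le_iff₀ h] at h2
      refine h2.trans (mul_le_mul_of_nonneg_right ?_ h.le)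
      linarith [le_abs_self N]
  have hshift : ∀ x ∈ Icc (-(L/4)) (L/4), ∀ y ∈ Icc 0 (L/4), ∀ t ∈ Ico t0 T,
      ∀ a1 ∈ Ico 0 δ, ∀ a2 ∈ Ico 0 δ, ∀ b1 ∈ Ico 0 δ, ∀ b2 ∈ Ico 0 δ, b1 ≤ |b1 - b2| →
      u (x + a1) (y + b1) t - u (x + a2) (y + b2) t ≤ C * (|a1 - a2| + |b1 - b2|) := by
    intro x hx y hy t ht a1 ha1 a2 ha2 b1 hb1 b2 hb2 hbb
    have A : ∀ a ∈ Ico 0 δ, |a| ≤ L / 8 := fun a ha => by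
      rw [abs_of_nonneg ha.1]; linarith [ha.2]
    have B : ∀ a ∈ Ico 0 δ, 0 ≤ a ∧ a ≤ L / 8 := fun a ha => ⟨ha.1, by linarith [ha.2]⟩
    have htT : 0 ≤ (0:ℝ) ∧ t + 0 < T := ⟨le_rfl, by linarith [ht.2]⟩
    have := aux_comp p L T hp hL u hsol a1 a2 a2 b1 b2 b2 0 0 0 t0 t (C * (|a1 - a2| + |b1 - b2|))
      (A _ ha1) (A _ ha2) (A _ ha2) (B _ hb1) (B _ hb2) (B _ hb2) htT htT htT (by linarith) ?_
      x hx y hy t ⟨ht.1, le_rfl⟩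
    · simp only [add_zero] at this
      linarith
    · intro X hX Y hY S hS hbd
      simp only [add_zero]
      have hS' : S ∈ Ico t0 T := ⟨hS.1, lt_of_le_of_lt hS.2 ht.2⟩
      have hST : S ∈ Ioo 0 T := ⟨by linarith [hS.1], hS'.2⟩
      by_cases hY0 : Y = 0
      · have e1 : u (X + a1) (Y + b1) S ≤ C * b1 := by
          rw [hY0, zero_add]
          refine (aux_mono p L T u hsol hmon (abs_lt.2 ⟨?_, ?_⟩) ⟨hb1.1, ?_⟩ hST).trans
            (hlin b1 hb1 S hS')
          · linarith [hX.1, ha1.1]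
          · linarith [hX.2, ha1.2]
          · linarith [hb1.2]
        have e2 : 0 ≤ u (X + a2) (Y + b2) S := by
          refine hsol.nonneg (abs_le.2 ⟨?_, ?_⟩) ⟨?_, ?_⟩ hST
          · linarith [hX.1, ha2.1]
          · linarith [hX.2, ha2.2]
          · linarith [hb2.1]
          · linarith [hb2.2]
        have e3 : C * b1 ≤ C * (|a1 - a2| + |b1 - b2|) :=
          mul_le_mul_of_nonneg_left (by linarith [abs_nonneg (a1 - a2)]) hC0
        linarith
      · have hin : ∀ s ∈ Icc X (X + L / 8), ∀ z ∈ Icc Y (Y + L / 8), Reg u s z S ∧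
            |pdx u s z S| ≤ M ∧ |pdy u s z S| ≤ M ∧ |pdt u s z S| ≤ M ∧ |pdxx u s z S| ≤ M := by
          intro s hs z hz
          refine hB s z S (abs_le.2 ⟨by linarith [hX.1, hs.1], by linarith [hX.2, hs.2]⟩)
            ⟨by linarith [hY.1, hz.1], by linarith [hY.2, hz.2]⟩ ⟨by linarith [hS.1], hS'.2.le⟩ ?_
          rcases hbd with h | h | h | h | h
          · left; rw [abs_of_neg (by linarith [hs.2])]; linarith [hs.2]
          · left; rw [abs_of_pos (by linarith [hs.1])]; linarith [hs.1]
          · exact absurd h hY0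
          · right; left; linarith [hz.1]
          · right; right; linarith
        have I1 : ∀ Z, ∀ a ∈ Ico 0 δ, Z + a ∈ Icc Z (Z + L / 8) := fun Z a ha =>
          ⟨by linarith [ha.1], by linarith [ha.2]⟩
        have l1 : |u (X + a1) (Y + b1) S - u (X + a2) (Y + b1) S| ≤ M * |X + a1 - (X + a2)| := by
          refine aux_lip (f := fun s => u s (Y + b1) S) ?_
          intro s hs
          have h := hin s (uIcc_subset_Icc (I1 X a2 ha2) (I1 X a1 ha1) hs) _ (I1 Y b1 hb1)
          exact ⟨h.1.dx, h.2.1⟩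
        have l2 : |u (X + a2) (Y + b1) S - u (X + a2) (Y + b2) S| ≤ M * |Y + b1 - (Y + b2)| := by
          refine aux_lip (f := fun s => u (X + a2) s S) ?_
          intro s hs
          have h := hin _ (I1 X a2 ha2) s (uIcc_subset_Icc (I1 Y b2 hb2) (I1 Y b1 hb1) hs)
          exact ⟨h.1.dy, h.2.2.1⟩
        rw [add_sub_add_left_eq_sub] at l1 l2
        have l1' := (abs_le.1 l1).2
        have l2' := (abs_le.1 l2).2
        have e3 : M * (|a1 - a2| + |b1 - b2|) ≤ C * (|a1 - a2| + |b1 - b2|) :=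
          mul_le_mul_of_nonneg_right (by linarith) (by positivity)
        linarith
  obtain ⟨x, y, t, hx, hy, ht, hx', hy', ht', hbig⟩ := hgbu.blowup (2 * C) (min (L/4) (T - t0))
    (lt_min (by linarith) (by linarith))
  have hx2 := abs_le.1 (hx'.trans_le (min_le_left _ _)).le
  have hy2 : y ∈ Icc 0 (L/4) := ⟨hy.1, (abs_le.1 (hy'.trans_le (min_le_left _ _)).le).2⟩
  have ht2 : t ∈ Ico t0 T := ⟨by linarith [min_le_right (L/4) (T - t0)], ht.2⟩
  have hreg := (hsol.smooth hx hy ht).reg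
  have z : (0:ℝ) ∈ Ico 0 δ := ⟨le_rfl, hδ⟩
  have H := hshift x hx2 y hy2 t ht2
  have d1 : pdx u x y t ≤ C := aux_deriv_le hreg.dx hδ (fun k hk hk2 => by
    have := H k ⟨hk.le, hk2⟩ 0 z 0 z 0 z (by simp)
    simpa [abs_of_pos hk] using this)
  have d2 : -pdx u x y t ≤ C := by
    rw [← show _ = -pdx u x y t from hreg.dx.hasDerivAt.neg.deriv]
    refine aux_deriv_le hreg.dx.neg hδ (fun k hk hk2 => ?_)
    have := H 0 z k ⟨hk.le, hk2⟩ 0 z 0 z (by simp)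
    simp [abs_of_pos hk] at this ⊢
    linarith
  have d3 : pdy u x y t ≤ C := aux_deriv_le hreg.dy hδ (fun k hk hk2 => by
    have := H 0 z 0 z k ⟨hk.le, hk2⟩ 0 z (by simp [le_abs_self])
    simpa [abs_of_pos hk] using this)
  have d4 : -pdy u x y t ≤ C := by
    rw [← show _ = -pdy u x y t from hreg.dy.hasDerivAt.neg.deriv]
    refine aux_deriv_le hreg.dy.neg hδ (fun k hk hk2 => ?_)
    have := H 0 z 0 z 0 z k ⟨hk.le, hk2⟩ (by simp)
    simp [abs_of_pos hk] at this ⊢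
    linarith
  have : gradNorm u x y t ≤ 2 * C := by
    unfold gradNorm
    rw [Real.sqrt_le_left (by linarith)]
    nlinarith [sq_nonneg (pdx u x y t), sq_nonneg (pdy u x y t)]
  linarith

lemma aux_ode (p M β : ℝ) (hp : 2 < p) (hβ : β = 1 / (p - 1)) :
    ∃ y1 : ℝ, 0 < y1 ∧ ∀ (η y0 Y : ℝ) (f : ℝ → ℝ), 0 < η → 0 < y0 → y0 ≤ Y → Y + η ≤ y1 →
      (∀ y ∈ Icc y0 Y, DifferentiableAt ℝ f y ∧ DifferentiableAt ℝ (deriv f) y ∧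
        -M - |deriv f y| ^ p ≤ deriv (deriv f) y) →
      3 / 4 * β ^ β * η ^ (-β) ≤ deriv f y0 →
      f y0 + 3 / 4 * β ^ β * (1 - β)⁻¹ * ((Y + η) ^ (1 - β) - (y0 + η) ^ (1 - β)) ≤ f Y := by
  have hβ0 : 0 < β := by rw [hβ]; apply div_pos <;> linarith
  have hβ1 : β < 1 := by rw [hβ, div_lt_one (by linarith)]; linarith
  have hβp : β * p = β + 1 := by
    rw [hβ]; have : p - 1 ≠ 0 := by linarith
    field_simp; ring
  set A := 3 / 4 * β ^ β with hA
  have hββ : 0 < β ^ β := Real.rpow_pos_of_pos hβ0 _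
  have hA0 : 0 < A := by positivity
  have hG : 0 < β * A - A ^ p := by
    have e1 : A ^ p = (3/4 : ℝ) ^ p * (β ^ β * β) := by
      rw [hA, Real.mul_rpow (by norm_num) hββ.le, ← Real.rpow_mul hβ0.le, hβp,
        Real.rpow_add_one hβ0.ne']
    have e2 : (3/4 : ℝ) ^ p < 3/4 := by
      have := Real.rpow_lt_rpow_of_exponent_gt (x := 3/4) (by norm_num) (by norm_num)
        (show (1:ℝ) < p by linarith)
      simpa using this
    rw [e1, hA]
    have : 0 < β ^ β * β := by positivity
    nlinarith
  set G := β * A - A ^ p with hGdef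
  obtain ⟨y1, hy1, hy1M⟩ : ∃ y1 : ℝ, 0 < y1 ∧ M < G * y1 ^ (-β - 1) := by
    have h := (tendsto_rpow_neg_nhdsGT_zero (show -β - 1 < 0 by linarith)).eventually_gt_atTop (M / G)
    obtain ⟨y1, h1, h2⟩ := (h.and self_mem_nhdsWithin).exists
    refine ⟨y1, h2, ?_⟩
    rw [div_lt_iff₀ hG] at h1
    linarith
  refine ⟨y1, hy1, ?_⟩
  intro η y0 Y f hη hy0 hyY hY hf h0
  have hpos : ∀ y ∈ Icc y0 Y, 0 < y + η := fun y hy => by linarith [hy.1]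
  have hid : ∀ y : ℝ, HasDerivAt (fun s => s + η) 1 y := fun y => (hasDerivAt_id y).add_const η
  have hW : ∀ y ∈ Icc y0 Y, HasDerivAt (fun s => A * (s + η) ^ (-β))
      (A * (-β * (y + η) ^ (-β - 1))) y := by
    intro y hy
    have := ((hid y).rpow_const (p := -β) (Or.inl (hpos y hy).ne')).const_mul A
    simpa using this
  have hcmp : ∀ y ∈ Icc y0 Y, A * (y + η) ^ (-β) ≤ deriv f y := by
    refine image_le_of_deriv_right_lt_deriv_boundary'
      (f' := fun y => A * (-β * (y + η) ^ (-β - 1))) (B' := fun y => deriv (deriv f) y) ?_ ?_ ?_ ?_ ?_ ?_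
    · intro y hy
      exact (hW y hy).continuousAt.continuousWithinAt
    · intro y hy
      exact (hW y (Ico_subset_Icc_self hy)).hasDerivWithinAt
    · refine le_trans (mul_le_mul_of_nonneg_left ?_ hA0.le) h0
      exact Real.rpow_le_rpow_of_nonpos hη (by linarith) (by linarith)
    · intro y hy
      exact (hf y hy).2.1.continuousAt.continuousWithinAt
    · intro y hy
      exact (hf y (Ico_subset_Icc_self hy)).2.1.hasDerivAt.hasDerivWithinAt
    · intro y hy he
      have hy' := Ico_subset_Icc_self hy
      refine lt_of_lt_of_le ?_ (hf y hy').2.2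
      rw [← he]
      have hp1 : 0 < (y + η) ^ (-β) := Real.rpow_pos_of_pos (hpos y hy') _
      rw [abs_of_pos (mul_pos hA0 hp1), Real.mul_rpow hA0.le hp1.le, ← Real.rpow_mul (hpos y hy').le,
        show -β * p = -β - 1 by linarith]
      have h2 : y1 ^ (-β - 1) ≤ (y + η) ^ (-β - 1) :=
        Real.rpow_le_rpow_of_nonpos (hpos y hy') (by linarith [hy.2]) (by linarith)
      have h3 := mul_le_mul_of_nonneg_left h2 hG.le
      have h4 : G * (y + η) ^ (-β - 1) = β * A * (y + η) ^ (-β - 1) - A ^ p * (y + η) ^ (-β - 1) := by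
        rw [hGdef]; ring
      linarith
  have hP : ∀ y ∈ Icc y0 Y, HasDerivAt (fun s => A * (1 - β)⁻¹ * (s + η) ^ (1 - β))
      (A * (y + η) ^ (-β)) y := by
    intro y hy
    have := ((hid y).rpow_const (p := 1 - β) (Or.inl (hpos y hy).ne')).const_mul (A * (1 - β)⁻¹)
    have e : A * (y + η) ^ (-β) = A * (1 - β)⁻¹ * (1 * (1 - β) * (y + η) ^ (1 - β - 1)) := by
      have : 1 - β ≠ 0 := by linarith
      rw [show 1 - β - 1 = -β by ring]
      field_simp
    rw [e]
    exact this
  have hm : MonotoneOn (fun s => f s - A * (1 - β)⁻¹ * (s + η) ^ (1 - β)) (Icc y0 Y) := by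
    apply monotoneOn_of_deriv_nonneg (convex_Icc _ _)
    · intro y hy
      exact ((hf y hy).1.hasDerivAt.sub (hP y hy)).continuousAt.continuousWithinAt
    · intro y hy
      have hy := interior_subset hy
      exact ((hf y hy).1.hasDerivAt.sub (hP y hy)).differentiableAt.differentiableWithinAt
    · intro y hy
      have hy := interior_subset hy
      have e : deriv (fun s => f s - A * (1 - β)⁻¹ * (s + η) ^ (1 - β)) y =
        deriv f y - A * (y + η) ^ (-β) := ((hf y hy).1.hasDerivAt.sub (hP y hy)).deriv
      rw [e]
      linarith [hcmp y hy]
  have := hm (left_mem_Icc.2 hyY) (right_mem_Icc.2 hyY) hyY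
  simp only at this
  rw [mul_sub]
  linarith

lemma aux_axis (p L T β : ℝ) (hp : 2 < p) (hβ : β = 1 / (p - 1)) (hL : 0 < L) (hT : 0 < T)
    (u : ℝ → ℝ → ℝ → ℝ)
    (hsol : ClassicalSolution p L T u) (hgbu : IsolatedGBU L T u) (hext : ExtC21 L T u)
    (hmon : MonCond L T u) : ∃ ρ : ℝ, 0 < ρ ∧ ρ ≤ L / 8 ∧ ∀ Y ∈ Ioo 0 ρ,
      3 / 4 * β ^ β * (1 - β)⁻¹ * Y ^ (1 - β) ≤ u 0 Y T := by
  have hβ0 : 0 < β := by rw [hβ]; apply div_pos <;> linarith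
  have hβ1 : β < 1 := by rw [hβ, div_lt_one (by linarith)]; linarith
  obtain ⟨M, hM, hut⟩ := aux_ut p L T hp hL hT u hsol hext
  obtain ⟨y1, hy1, hode⟩ := aux_ode p M β hp hβ
  refine ⟨min (y1 / 2) (L / 8), lt_min (by linarith) (by linarith), min_le_right _ _, ?_⟩
  intro Y hY
  have hY1 := hY.2.trans_le (min_le_left _ _)
  have hY2 := hY.2.trans_le (min_le_right _ _)
  set D := 3 / 4 * β ^ β * (1 - β)⁻¹ with hD
  have hD0 : 0 ≤ D := by
    have : 0 < 1 - β := by linarith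
    positivity
  have step : ∀ η, 0 < η → η < Y → D * ((Y + η) ^ (1 - β) - (2 * η) ^ (1 - β)) ≤ u 0 Y T := by
    intro η hη hηY
    by_contra hn
    push Not at hn
    have c0 := aux_ctT hT hext (x := 0) (y := Y) (by rw [abs_zero]; linarith) ⟨hY.1, by linarith⟩
    obtain ⟨ε, hε, hε2⟩ := Metric.eventually_nhds_iff.1 (c0.eventually (gt_mem_nhds hn))
    obtain ⟨y0, hy0, t, ht, ht0, hbig⟩ := aux_blow p L T hp hL hT u hsol hgbu hext hmon
      (3 / 4 * β ^ β * η ^ (-β)) (min (min ε η) (min (T / 2) (L / 8)))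
      (lt_min (lt_min hε hη) (lt_min (by linarith) (by linarith)))
      ((min_le_right _ _).trans (min_le_right _ _))
    have m1 : min (min ε η) (min (T / 2) (L / 8)) ≤ ε := (min_le_left _ _).trans (min_le_left _ _)
    have m2 : min (min ε η) (min (T / 2) (L / 8)) ≤ η := (min_le_left _ _).trans (min_le_right _ _)
    have m3 : min (min ε η) (min (T / 2) (L / 8)) ≤ T / 2 := (min_le_right _ _).trans (min_le_left _ _)
    have htT : t ∈ Ioo 0 T := ⟨ht0, ht.2⟩
    have hup := hε2 (show dist t T < ε by
      rw [Real.dist_eq, abs_lt]; constructor <;> linarith [ht.1, ht.2])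
    have z : |(0:ℝ)| < L := by rw [abs_zero]; exact hL
    have hlow := hode η y0 Y (fun s => u 0 s t) hη hy0.1 (by linarith [hy0.2]) (by linarith) ?_ hbig.le
    · have hnn : 0 ≤ u 0 y0 t := hsol.nonneg z.le ⟨hy0.1.le, by linarith [hy0.2]⟩ htT
      have h2 : (y0 + η) ^ (1 - β) ≤ (2 * η) ^ (1 - β) :=
        Real.rpow_le_rpow (by linarith [hy0.1]) (by linarith [hy0.2]) (by linarith)
      have h3 : D * ((Y + η) ^ (1 - β) - (2 * η) ^ (1 - β)) ≤
        D * ((Y + η) ^ (1 - β) - (y0 + η) ^ (1 - β)) :=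
        mul_le_mul_of_nonneg_left (by linarith) hD0
      linarith
    · intro y hy
      have hy0' : 0 < y := lt_of_lt_of_le hy0.1 hy.1
      have hr := (hsol.smooth z.le ⟨hy0'.le, by linarith [hy.2]⟩ htT).reg (y := y)
      refine ⟨hr.dy, hr.dyy, ?_⟩
      have hpde := hsol.pde z ⟨hy0', by linarith [hy.2]⟩ htT (y := y)
      obtain ⟨x1, x2⟩ := aux_max0 p L T hL u hsol hmon (y := y) ⟨hy0'.le, by linarith [hy.2]⟩ htT
      have h1 := hut 0 ⟨by linarith, by linarith⟩ y ⟨hy0'.le, by linarith [hy.2]⟩ t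
        ⟨by linarith [ht.1], ht.2⟩
      have hg : gradNorm u 0 y t = |pdy u 0 y t| := by
        unfold gradNorm
        rw [x1, zero_pow two_ne_zero, zero_add, Real.sqrt_sq_eq_abs]
      rw [hg] at hpde
      change -M - |pdy u 0 y t| ^ p ≤ pdyy u 0 y t
      linarith
  have hcont : ContinuousAt (fun η : ℝ => D * ((Y + η) ^ (1 - β) - (2 * η) ^ (1 - β))) 0 := by
    have k1 : ContinuousAt (fun η : ℝ => (Y + η) ^ (1 - β)) 0 :=
      ContinuousAt.rpow_const (by fun_prop) (Or.inr (by linarith))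
    have k2 : ContinuousAt (fun η : ℝ => (2 * η) ^ (1 - β)) 0 :=
      ContinuousAt.rpow_const (by fun_prop) (Or.inr (by linarith))
    exact (k1.sub k2).const_mul D
  have hlim := hcont.tendsto.mono_left (nhdsWithin_le_nhds (s := Ioi 0))
  simp only [add_zero, mul_zero, Real.zero_rpow (show 1 - β ≠ 0 by linarith), sub_zero] at hlim
  refine le_of_tendsto hlim ?_
  filter_upwards [Ioo_mem_nhdsGT hY.1] with η hη using step η hη.1 hη.2

/-- Step 1 in the proof of Lemma 3.2: lower estimate for the final profile
`v = u(·,·,T)` in the region `{y ≥ K x^{2/(1-β)}}`: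
`v(x,y) ≥ (c_p/2) y^{1-β}` there, with `β = 1/(p-1)` and `c_p = (1-β)⁻¹ β^β`. -/
theorem v_lower_above_parabola (p L T : ℝ) (hp : 2 < p)
    (hL : 0 < L) (hT : 0 < T) (u : ℝ → ℝ → ℝ → ℝ)
    (hsol : ClassicalSolution p L T u) (hgbu : IsolatedGBU L T u)
    (hext : ExtC21 L T u) (hmon : MonCond L T u) :
    ∃ K ρ : ℝ, 0 < K ∧ 0 < ρ ∧ ρ < L ∧
      ∀ x y : ℝ, |x| < ρ → y ∈ Ioo (0:ℝ) ρ →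
        K * |x| ^ (2 / (1 - 1/(p-1))) ≤ y →
        (1 - 1/(p-1))⁻¹ * ((1/(p-1) : ℝ) ^ (1/(p-1))) / 2 * y ^ (1 - 1/(p-1))
          ≤ u x y T := by
  obtain ⟨β, hβ⟩ : ∃ β : ℝ, β = 1 / (p - 1) := ⟨_, rfl⟩
  have hβ0 : 0 < β := by rw [hβ]; apply div_pos <;> linarith
  have hβ1 : β < 1 := by rw [hβ, div_lt_one (by linarith)]; linarith
  rw [← hβ]
  obtain ⟨ρ, hρ, hρL, hax⟩ := aux_axis p L T β hp hβ hL hT u hsol hgbu hext hmon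
  obtain ⟨M, hM, hlow⟩ := aux_low p L T hp hL hT u hsol hext hmon
  have hc0 : 0 < (1 - β)⁻¹ * β ^ β := by
    have : 0 < 1 - β := by linarith
    positivity
  set c := (1 - β)⁻¹ * β ^ β with hc
  set γ := 1 - β with hγ
  have hγ0 : 0 < γ := by linarith
  set E := 4 * (M + 1) / c with hE
  have hE0 : 0 < E := by positivity
  refine ⟨E ^ (1 / γ), ρ, Real.rpow_pos_of_pos hE0 _, hρ, by linarith, ?_⟩
  intro x y hx hy hxy
  have h1 := hax y hy
  have h2 := hlow x y (by linarith) ⟨hy.1, by linarith [hy.2]⟩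
  have h3 : E * x ^ 2 ≤ y ^ γ := by
    have hp1 : 0 ≤ E ^ (1 / γ) := (Real.rpow_pos_of_pos hE0 _).le
    have hp2 : 0 ≤ |x| ^ (2 / γ) := Real.rpow_nonneg (abs_nonneg _) _
    have h := Real.rpow_le_rpow (mul_nonneg hp1 hp2) hxy hγ0.le
    rw [Real.mul_rpow hp1 hp2, ← Real.rpow_mul hE0.le, ← Real.rpow_mul (abs_nonneg x),
      div_mul_cancel₀ _ hγ0.ne', div_mul_cancel₀ _ hγ0.ne', Real.rpow_one, Real.rpow_two,
      sq_abs] at h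
    exact h
  have h4 : 4 * (M + 1) * x ^ 2 ≤ c * y ^ γ := by
    have h := mul_le_mul_of_nonneg_left h3 hc0.le
    have e : c * (E * x ^ 2) = 4 * (M + 1) * x ^ 2 := by rw [hE]; field_simp
    linarith
  have e : 3 / 4 * β ^ β * γ⁻¹ * y ^ γ = 3 / 4 * (c * y ^ γ) := by rw [hc]; ring
  rw [e] at h1
  have := sq_nonneg x
  linarith
end
end
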